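/- arXiv:2408.07043 — 2 statements merged into one kernel-verified Lean document; each statement's English description precedes it below -/
import Mathlib

section
/- Fix b ∈ (0,3) and let u be a global classical H² solution with nonnegative momentum of the b-family equation. Then there exists L ∈ ℝ such that lim_{t→∞} ∫_{Λ_{1/2}(t)} m(t,x) dx = L and lim_{t→∞} ∫_{Λ_{1/2}(t)} u(t,x) dx = L; since m(t,·) ≥ 0 and u(t,·) = G m(t,·) ≥ 0, these integrals are the L¹ norms ‖m(t)‖_{L¹(Λ_{1/2}(t))} and ‖u(t)‖_{L¹(Λ_{1/2}(t))}. -/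
open MeasureTheory Real Filter

/-- Convolution with the Green's function of `1 - d²/dx²` on `ℝ`. -/
noncomputable def G (f : ℝ → ℝ) (x : ℝ) : ℝ :=
  (1 / 2) * ∫ y : ℝ, Real.exp (-|x - y|) * f y

/-- The flux of the nonlocal `b`-family equation at time `t`:
`(1/2)u² + G((b/2)u² + ((3-b)/2)(∂ₓu)²)`. -/
noncomputable def flux (b : ℝ) (u : ℝ → ℝ → ℝ) (t : ℝ) : ℝ → ℝ :=
  fun y => (1 / 2) * (u t y) ^ 2
    + G (fun z => (b / 2) * (u t z) ^ 2 + ((3 - b) / 2) * (deriv (u t) z) ^ 2) y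

/-- The momentum `m = u - ∂ₓ²u`. -/
noncomputable def mom (u : ℝ → ℝ → ℝ) (t x : ℝ) : ℝ :=
  u t x - deriv (deriv (u t)) x

/-- `λ_c(t) = t^c / log t`. -/
noncomputable def lam (c t : ℝ) : ℝ := t ^ c / Real.log t

/-- `sech² z`. -/
noncomputable def sech2 (z : ℝ) : ℝ := (1 / Real.cosh z) ^ 2

/-- A global classical `H²` solution with nonnegative momentum of the nonlocal `b`-family
equation: `C¹` in `t`, `C³` in `x`, jointly continuous partial derivatives, solving the
equation pointwise on `(0,∞) × ℝ`, with `u(t,·), ∂ₓu(t,·), ∂ₓ²u(t,·) ∈ L¹(ℝ) ∩ L²(ℝ)`,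
nonnegative momentum `m(t,·) ≥ 0`, and conserved total momentum
`∫ m(t,x) dx = ∫ m(0,x) dx`. -/
def IsH2NonnegMomentumSolution (b : ℝ) (u : ℝ → ℝ → ℝ) : Prop :=
  (∀ x : ℝ, ContDiff ℝ 1 fun t => u t x) ∧
  (∀ t : ℝ, ContDiff ℝ 3 (u t)) ∧
  Continuous (fun p : ℝ × ℝ => u p.1 p.2) ∧
  Continuous (fun p : ℝ × ℝ => deriv (fun s => u s p.2) p.1) ∧
  Continuous (fun p : ℝ × ℝ => deriv (u p.1) p.2) ∧
  Continuous (fun p : ℝ × ℝ => deriv (deriv (u p.1)) p.2) ∧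
  Continuous (fun p : ℝ × ℝ => deriv (fun s => deriv (u s) p.2) p.1) ∧
  Continuous (fun p : ℝ × ℝ => deriv (fun s => deriv (deriv (u s)) p.2) p.1) ∧
  (∀ t x : ℝ, 0 < t → deriv (fun s => u s x) t + deriv (flux b u t) x = 0) ∧
  (∀ t : ℝ, 0 ≤ t →
    Integrable (u t) ∧ Integrable (fun x => (u t x) ^ 2)
    ∧ Integrable (deriv (u t)) ∧ Integrable (fun x => (deriv (u t) x) ^ 2)
    ∧ Integrable (deriv (deriv (u t))) ∧ Integrable (fun x => (deriv (deriv (u t)) x) ^ 2)) ∧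
  (∀ t x : ℝ, 0 ≤ t → 0 ≤ mom u t x) ∧
  (∀ t : ℝ, 0 ≤ t → ∫ x : ℝ, mom u t x = ∫ x : ℝ, mom u 0 x)

/-! ### The kernel -/

lemma integrable_kernel : Integrable (fun x : ℝ => Real.exp (-|x|)) := by
  refine (integrable_inv_one_add_sq.const_mul 2).mono' (by fun_prop) (ae_of_all _ fun x => ?_)
  rw [Real.norm_eq_abs, abs_of_pos (Real.exp_pos _), Real.exp_neg, ← div_eq_mul_inv,
    inv_eq_one_div, div_le_div_iff₀ (Real.exp_pos _) (by positivity)]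
  have := Real.quadratic_le_exp_of_nonneg (abs_nonneg x)
  rw [sq_abs] at this
  nlinarith [abs_nonneg x]

lemma kernel_lip (a b : ℝ) : |Real.exp (-|a|) - Real.exp (-|b|)| ≤ |a - b| := by
  have key : ∀ a b : ℝ, Real.exp (-|a|) - Real.exp (-|b|) ≤ |a - b| := by
    intro a b
    have h1 : Real.exp (-|a|) ≤ 1 := Real.exp_le_one_iff.2 (by simp)
    have h3 : 1 + (|a| - |b|) ≤ Real.exp (|a| - |b|) := by
      linarith [Real.add_one_le_exp (|a| - |b|)]
    have h4 : Real.exp (-|b|) = Real.exp (-|a|) * Real.exp (|a| - |b|) := by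
      rw [← Real.exp_add]; ring_nf
    have h5 := abs_sub_abs_le_abs_sub b a
    rw [abs_sub_comm] at h5
    rw [h4]
    nlinarith [Real.exp_pos (-|a|), mul_le_mul_of_nonneg_left h3 (Real.exp_pos (-|a|)).le,
      abs_nonneg (a - b)]
  rw [abs_le]
  constructor
  · have := key b a
    rw [abs_sub_comm] at this; linarith
  · exact key a b

lemma kernel_mul_integrable {f : ℝ → ℝ} (hf : Integrable f) (x : ℝ) :
    Integrable (fun y => Real.exp (-|x - y|) * f y) := by
  refine hf.norm.mono' ?_ (ae_of_all _ fun y => ?_)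
  · exact (by fun_prop : Continuous fun y : ℝ => Real.exp (-|x - y|)).aestronglyMeasurable.mul
      hf.aestronglyMeasurable
  · rw [norm_mul, Real.norm_eq_abs, abs_of_pos (Real.exp_pos _)]
    exact mul_le_of_le_one_left (norm_nonneg _) (Real.exp_le_one_iff.2 (by simp))

lemma G_nonneg {f : ℝ → ℝ} (h0 : ∀ x, 0 ≤ f x) (x : ℝ) : 0 ≤ G f x := by
  unfold G
  have : 0 ≤ ∫ y : ℝ, Real.exp (-|x - y|) * f y :=
    integral_nonneg fun y => mul_nonneg (Real.exp_pos _).le (h0 y)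
  linarith

lemma kernel_hasDerivAt (x y : ℝ) (h : y ≠ x) :
    ∃ c : ℝ, |c| ≤ Real.exp (-|x - y|) ∧ HasDerivAt (fun z => Real.exp (-|z - y|)) c x := by
  have h1 : x - y ≠ 0 := sub_ne_zero.2 h.symm
  have h2 : HasDerivAt (fun z => |z - y|) (SignType.sign (x - y) : ℝ) x := by
    have := (hasDerivAt_abs h1).comp x ((hasDerivAt_id x).sub_const y)
    simpa [Function.comp_def] using this
  refine ⟨_, ?_, h2.neg.exp⟩
  rw [abs_mul, abs_of_pos (Real.exp_pos _), abs_neg]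
  apply mul_le_of_le_one_right (Real.exp_pos _).le
  rcases lt_or_gt_of_ne h1 with h | h <;> simp [h]

lemma G_deriv {f : ℝ → ℝ} (hf : Integrable f) (h0 : ∀ x, 0 ≤ f x) (x : ℝ) :
    DifferentiableAt ℝ (G f) x ∧ |deriv (G f) x| ≤ G f x := by
  have hd : ∀ y, y ≠ x → HasDerivAt (fun z => Real.exp (-|z - y|) * f y)
      (deriv (fun z => Real.exp (-|z - y|)) x * f y) x := by
    intro y hy
    obtain ⟨c, hc, h⟩ := kernel_hasDerivAt x y hy
    rw [h.deriv]
    exact h.mul_const _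
  have hb : ∀ y, y ≠ x → ‖deriv (fun z => Real.exp (-|z - y|)) x * f y‖
      ≤ Real.exp (-|x - y|) * f y := by
    intro y hy
    obtain ⟨c, hc, h⟩ := kernel_hasDerivAt x y hy
    rw [h.deriv, norm_mul, Real.norm_eq_abs, Real.norm_eq_abs, abs_of_nonneg (h0 y)]
    exact mul_le_mul_of_nonneg_right hc (h0 y)
  have hae : ∀ᵐ y : ℝ, y ≠ x := by
    simp [ae_iff]
  have hmeas : Measurable fun y : ℝ => deriv (fun z => Real.exp (-|z - y|)) x := by
    have : (fun y : ℝ => deriv (fun z => Real.exp (-|z - y|)) x)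
        = fun y => deriv (fun w : ℝ => Real.exp (-|w|)) (x - y) := by
      ext y
      exact deriv_comp_sub_const (fun w : ℝ => Real.exp (-|w|)) y x
    rw [this]
    exact (measurable_deriv _).comp (by fun_prop)
  have := hasDerivAt_integral_of_dominated_loc_of_lip (μ := volume) (s := Set.univ) (x₀ := x)
    (F := fun z y => Real.exp (-|z - y|) * f y)
    (F' := fun y => deriv (fun z => Real.exp (-|z - y|)) x * f y) (bound := f)
    univ_mem (Eventually.of_forall fun z => (kernel_mul_integrable hf z).aestronglyMeasurable)
    (kernel_mul_integrable hf x) (hmeas.aestronglyMeasurable.mul hf.aestronglyMeasurable)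
    (ae_of_all _ fun y => LipschitzOnWith.of_dist_le_mul fun a _ b _ => by
      simp only [Real.dist_eq, Real.coe_nnabs, abs_of_nonneg (h0 y)]
      rw [← sub_mul, abs_mul, abs_of_nonneg (h0 y), mul_comm]
      apply mul_le_mul_of_nonneg_left _ (h0 y)
      simpa using kernel_lip (a - y) (b - y))
    hf (hae.mono hd)
  obtain ⟨hi, hD⟩ := this
  have hG : HasDerivAt (G f) ((1 / 2) * ∫ y, deriv (fun z => Real.exp (-|z - y|)) x * f y) x :=
    hD.const_mul (1 / 2)
  refine ⟨hG.differentiableAt, ?_⟩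
  rw [hG.deriv]
  unfold G
  rw [abs_mul, abs_of_pos (by norm_num : (0:ℝ) < 1 / 2)]
  gcongr
  exact norm_integral_le_of_norm_le (kernel_mul_integrable hf x) (hae.mono hb)

/-- total mass of the kernel -/
noncomputable def kmass : ℝ := (1 / 2) * ∫ x : ℝ, Real.exp (-|x|)

lemma kmass_nonneg : 0 ≤ kmass := by
  unfold kmass
  have : 0 ≤ ∫ x : ℝ, Real.exp (-|x|) := integral_nonneg fun x => (Real.exp_pos _).le
  linarith

lemma G_integrable {f : ℝ → ℝ} (hf : Integrable f) :
    Integrable (G f) ∧ ∫ x, G f x = kmass * ∫ x, f x := by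
  have h1 := hf.integrable_convolution (ContinuousLinearMap.mul ℝ ℝ) integrable_kernel
  have h2 := integral_convolution (ContinuousLinearMap.mul ℝ ℝ) hf integrable_kernel
  have e : G f = fun x => (1 / 2) *
      (MeasureTheory.convolution f (fun x : ℝ => Real.exp (-|x|))
        (ContinuousLinearMap.mul ℝ ℝ) volume) x := by
    ext x
    unfold G MeasureTheory.convolution
    congr 2
    ext y
    simp [mul_comm]
  constructor
  · rw [e]; exact h1.const_mul _
  · rw [e, integral_const_mul, h2]
    simp only [ContinuousLinearMap.mul_apply', kmass]
    ring

/-! ### Fixed-time facts -/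

lemma slice_facts {v : ℝ → ℝ} (hv : ContDiff ℝ 3 v) (i0 : Integrable v) (i1 : Integrable (deriv v))
    (i2 : Integrable (deriv (deriv v))) (hm : ∀ x, 0 ≤ v x - deriv (deriv v) x) :
    (∀ x, |deriv v x| ≤ v x) ∧ (∀ x, v x ≤ ∫ y, v y) ∧
      ∫ x, (v x - deriv (deriv v) x) = ∫ x, v x := by
  have d0 : ∀ x, HasDerivAt v (deriv v x) x := fun x =>
    (hv.differentiable (by norm_num) x).hasDerivAt
  have hv1 : ContDiff ℝ 2 (deriv v) := by
    have : ContDiff ℝ (2 + 1) v := by norm_num; exact hv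
    exact (contDiff_succ_iff_deriv.1 this).2.2
  have d1 : ∀ x, HasDerivAt (deriv v) (deriv (deriv v) x) x := fun x =>
    (hv1.differentiable (by norm_num) x).hasDerivAt
  have t0 : Tendsto v atBot (nhds 0) :=
    tendsto_zero_of_hasDerivAt_of_integrableOn_Iic (a := 0) (fun x _ => d0 x) i1.integrableOn
      i0.integrableOn
  have t0' : Tendsto v atTop (nhds 0) :=
    tendsto_zero_of_hasDerivAt_of_integrableOn_Ioi (a := 0) (fun x _ => d0 x) i1.integrableOn
      i0.integrableOn
  have t1 : Tendsto (deriv v) atBot (nhds 0) :=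
    tendsto_zero_of_hasDerivAt_of_integrableOn_Iic (a := 0) (fun x _ => d1 x) i2.integrableOn
      i1.integrableOn
  have t1' : Tendsto (deriv v) atTop (nhds 0) :=
    tendsto_zero_of_hasDerivAt_of_integrableOn_Ioi (a := 0) (fun x _ => d1 x) i2.integrableOn
      i1.integrableOn
  have A : ∀ x, 0 ≤ v x - deriv v x := by
    have hmono : Monotone fun x => Real.exp x * (v x - deriv v x) := by
      apply monotone_of_hasDerivAt_nonneg
        (f' := fun x => Real.exp x * (v x - deriv (deriv v) x))
      · intro x
        have := (Real.hasDerivAt_exp x).mul ((d0 x).sub (d1 x))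
        refine HasDerivAt.congr_deriv this ?_
        simp only [Pi.sub_apply]; ring
      · intro x; exact mul_nonneg (Real.exp_pos x).le (hm x)
    have hl : Tendsto (fun x => Real.exp x * (v x - deriv v x)) atBot (nhds 0) := by
      simpa using Real.tendsto_exp_atBot.mul (t0.sub t1)
    intro x
    have := hmono.le_of_tendsto hl x
    exact nonneg_of_mul_nonneg_right this (Real.exp_pos x)
  have B : ∀ x, 0 ≤ v x + deriv v x := by
    have hmono : Antitone fun x => Real.exp (-x) * (v x + deriv v x) := by
      apply antitone_of_hasDerivAt_nonpos
        (f' := fun x => - (Real.exp (-x) * (v x - deriv (deriv v) x)))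
      · intro x
        have := ((hasDerivAt_id x).neg.exp).mul ((d0 x).add (d1 x))
        refine HasDerivAt.congr_deriv this ?_
        simp only [Pi.add_apply, Pi.neg_apply, id]; ring
      · intro x
        have := mul_nonneg (Real.exp_pos (-x)).le (hm x)
        simpa using this
    have hl : Tendsto (fun x => Real.exp (-x) * (v x + deriv v x)) atTop (nhds 0) := by
      simpa using (Real.tendsto_exp_neg_atTop_nhds_zero).mul (t0'.add t1')
    intro x
    have := hmono.le_of_tendsto hl x
    exact nonneg_of_mul_nonneg_right this (Real.exp_pos _)
  have C : ∀ x, |deriv v x| ≤ v x := fun x => abs_le.2 ⟨by linarith [B x], by linarith [A x]⟩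
  have v0 : ∀ x, 0 ≤ v x := fun x => (abs_nonneg _).trans (C x)
  refine ⟨C, ?_, ?_⟩
  · intro x
    have h := integral_Iic_of_hasDerivAt_of_tendsto' (a := x) (fun y _ => d0 y) i1.integrableOn t0
    have : v x = ∫ y in Set.Iic x, deriv v y := by rw [h]; ring
    rw [this]
    calc _ ≤ ∫ y in Set.Iic x, v y := by
            apply integral_mono i1.integrableOn i0.integrableOn
            intro y; exact (le_abs_self _).trans (C y)
      _ ≤ ∫ y, v y := setIntegral_le_integral i0 (ae_of_all _ v0)
  · rw [integral_sub i0 i2, integral_of_hasDerivAt_of_tendsto d1 i2 t1 t1']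
    ring

lemma sol_facts {b : ℝ} (hb : b ∈ Set.Ioo (0 : ℝ) 3) {u : ℝ → ℝ → ℝ}
    (hu : IsH2NonnegMomentumSolution b u) {t : ℝ} (ht : 0 ≤ t) :
    (∀ x, |deriv (u t) x| ≤ u t x) ∧ (∀ x, u t x ≤ ∫ y, mom u 0 y) ∧
      ∫ x, u t x = ∫ y, mom u 0 y := by
  obtain ⟨-, hC3, -, -, -, -, -, -, -, hI, hm, hcons⟩ := hu
  obtain ⟨a, b', c⟩ := slice_facts (hC3 t) (hI t ht).1 (hI t ht).2.2.1 (hI t ht).2.2.2.2.1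
    (fun x => hm t x ht)
  have : ∫ x, u t x = ∫ y, mom u 0 y := by
    rw [← hcons t ht, ← c]; rfl
  exact ⟨a, fun x => this ▸ b' x, this⟩

lemma flux_facts {b : ℝ} (hb : b ∈ Set.Ioo (0 : ℝ) 3) {u : ℝ → ℝ → ℝ}
    (hu : IsH2NonnegMomentumSolution b u) {t : ℝ} (ht : 0 ≤ t) :
    Differentiable ℝ (flux b u t) ∧ Integrable (flux b u t) ∧ Integrable (deriv (flux b u t)) ∧
    (∀ x, (1 / 2) * (u t x) ^ 2 ≤ flux b u t x) ∧
    ∫ x, |deriv (flux b u t) x| ≤ (1 + (3 / 2) * kmass) * (∫ y, mom u 0 y) ^ 2 := by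
  obtain ⟨hx, hM, hint⟩ := sol_facts hb hu ht
  obtain ⟨-, hC3, -, -, -, -, -, -, -, hI, hm, hcons⟩ := hu
  obtain ⟨i0, i00, i1, i11, -, -⟩ := hI t ht
  have u0 : ∀ x, 0 ≤ u t x := fun x => (abs_nonneg _).trans (hx x)
  set M := ∫ y, mom u 0 y
  have hM0 : 0 ≤ M := (u0 0).trans (hM 0)
  set f : ℝ → ℝ := fun z => (b / 2) * (u t z) ^ 2 + ((3 - b) / 2) * (deriv (u t) z) ^ 2 with hf
  have f0 : ∀ x, 0 ≤ f x := fun x => by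
    have := hb.1; have := hb.2
    have h1 : 0 ≤ (3 - b) / 2 := by linarith
    have h2 : 0 ≤ b / 2 := by linarith
    simp only [hf]; positivity
  have fle : ∀ x, f x ≤ (3 / 2) * (u t x) ^ 2 := fun x => by
    have h3 : (deriv (u t) x) ^ 2 ≤ (u t x) ^ 2 := by
      rw [← sq_abs]; exact pow_le_pow_left₀ (abs_nonneg _) (hx x) 2
    have h1 : 0 ≤ (3 - b) / 2 := by linarith [hb.2]
    simp only [hf]
    nlinarith
  have fi : Integrable f := (i00.const_mul _).add (i11.const_mul _)
  have hG := G_deriv fi f0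
  obtain ⟨Gi, Gint⟩ := G_integrable fi
  have hd : ∀ x, HasDerivAt (flux b u t) (u t x * deriv (u t) x + deriv (G f) x) x := by
    intro x
    have d0 : HasDerivAt (u t) (deriv (u t) x) x :=
      ((hC3 t).differentiable (by norm_num) x).hasDerivAt
    have := ((d0.pow 2).const_mul (1 / 2)).add (hG x).1.hasDerivAt
    refine HasDerivAt.congr_deriv this ?_
    simp; ring
  have hbd : ∀ x, |deriv (flux b u t) x| ≤ (u t x) ^ 2 + G f x := by
    intro x
    rw [(hd x).deriv]
    refine (abs_add_le _ _).trans (add_le_add ?_ (hG x).2)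
    rw [abs_mul, abs_of_nonneg (u0 x), sq]
    exact mul_le_mul_of_nonneg_left (hx x) (u0 x)
  have bi : Integrable fun x => (u t x) ^ 2 + G f x := i00.add Gi
  have di : Integrable (deriv (flux b u t)) :=
    bi.mono' (measurable_deriv _).aestronglyMeasurable (ae_of_all _ hbd)
  have hsq : ∫ x, (u t x) ^ 2 ≤ M ^ 2 := by
    calc ∫ x, (u t x) ^ 2 ≤ ∫ x, M * u t x := by
          apply integral_mono i00 (i0.const_mul _)
          intro x
          simp only [sq]
          exact mul_le_mul_of_nonneg_right (hM x) (u0 x)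
      _ = M ^ 2 := by rw [integral_const_mul, hint, sq]
  refine ⟨fun x => (hd x).differentiableAt, (i00.const_mul _).add Gi, di, ?_, ?_⟩
  · intro x
    have := G_nonneg f0 x
    unfold flux
    linarith
  · calc ∫ x, |deriv (flux b u t) x| ≤ ∫ x, ((u t x) ^ 2 + G f x) := integral_mono di.abs bi hbd
      _ = (∫ x, (u t x) ^ 2) + kmass * ∫ x, f x := by rw [integral_add i00 Gi, Gint]
      _ ≤ M ^ 2 + kmass * ((3 / 2) * M ^ 2) := by
          have : ∫ x, f x ≤ (3 / 2) * M ^ 2 := by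
            calc ∫ x, f x ≤ ∫ x, (3 / 2) * (u t x) ^ 2 := integral_mono fi (i00.const_mul _) fle
              _ ≤ _ := by rw [integral_const_mul]; linarith
          have := mul_le_mul_of_nonneg_left this kmass_nonneg
          linarith
      _ = _ := by ring

/-! ### The scale -/

/-- derivative of `lam (1/2)` -/
noncomputable def lamD (s : ℝ) : ℝ := s ^ (-(1 / 2) : ℝ) * (1 / (2 * Real.log s) - 1 / (Real.log s) ^ 2)

lemma lam_pos {s : ℝ} (hs : 1 < s) : 0 < lam (1 / 2) s :=
  div_pos (Real.rpow_pos_of_pos (by linarith) _) (Real.log_pos hs)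

lemma lam_hasDerivAt {s : ℝ} (hs : 1 < s) : HasDerivAt (lam (1 / 2)) (lamD s) s := by
  have hs0 : 0 < s := by linarith
  have hl := Real.log_pos hs
  have := (Real.hasDerivAt_rpow_const (x := s) (p := 1 / 2) (Or.inl hs0.ne')).div
    (Real.hasDerivAt_log hs0.ne') hl.ne'
  refine HasDerivAt.congr_deriv this ?_
  unfold lamD
  have e : s ^ (1 / 2 : ℝ) = s ^ (-(1 / 2) : ℝ) * s := by
    rw [← Real.rpow_add_one hs0.ne']; norm_num
  rw [e]
  norm_num
  field_simp

lemma lamD_continuousOn : ContinuousOn lamD (Set.Ioi 1) := by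
  have h1 : ∀ s ∈ Set.Ioi (1:ℝ), s ≠ 0 := fun s hs => by
    have : (1:ℝ) < s := hs
    linarith
  have h2 : ∀ s ∈ Set.Ioi (1:ℝ), Real.log s ≠ 0 := fun s hs => (Real.log_pos hs).ne'
  unfold lamD
  refine ContinuousOn.mul (ContinuousOn.rpow_const continuousOn_id fun s hs => Or.inl (h1 s hs)) ?_
  have hl : ContinuousOn Real.log (Set.Ioi 1) := continuousOn_id.log h1
  refine ContinuousOn.sub (continuousOn_const.div (continuousOn_const.mul hl) ?_)
    (continuousOn_const.div (hl.pow 2) ?_)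
  · intro s hs; exact mul_ne_zero two_ne_zero (h2 s hs)
  · intro s hs; exact pow_ne_zero _ (h2 s hs)

lemma lam_continuousOn : ContinuousOn (lam (1 / 2)) (Set.Ioi 1) := fun s hs =>
  (lam_hasDerivAt hs).continuousAt.continuousWithinAt

lemma lam_sq {s : ℝ} (hs : 1 < s) : (lam (1 / 2) s) ^ 2 = s / (Real.log s) ^ 2 := by
  unfold lam
  rw [div_pow, ← Real.sqrt_eq_rpow, Real.sq_sqrt (by linarith)]

lemma two_le_log {s : ℝ} (hs : Real.exp 2 ≤ s) : 2 ≤ Real.log s :=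
  (Real.le_log_iff_exp_le ((Real.exp_pos 2).trans_le hs)).2 hs

lemma one_lt_of {s : ℝ} (hs : Real.exp 2 ≤ s) : 1 < s :=
  (Real.one_lt_exp_iff.2 two_pos).trans_le hs

lemma lamD_nonneg {s : ℝ} (hs : Real.exp 2 ≤ s) : 0 ≤ lamD s := by
  have h1 := one_lt_of hs
  have h2 := two_le_log hs
  refine mul_nonneg (Real.rpow_nonneg (by linarith) _) ?_
  rw [sub_nonneg, div_le_div_iff₀ (by positivity) (by positivity)]
  nlinarith

lemma lamD_sq_le {s : ℝ} (hs : Real.exp 2 ≤ s) : (lamD s) ^ 2 ≤ s⁻¹ / (Real.log s) ^ 2 := by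
  have h1 := one_lt_of hs
  have h2 := two_le_log hs
  unfold lamD
  rw [mul_pow, ← Real.rpow_natCast, ← Real.rpow_mul (by linarith)]
  norm_num
  rw [Real.rpow_neg_one, div_eq_mul_inv]
  refine mul_le_mul_of_nonneg_left ?_ (by positivity)
  have h3 : 0 < (Real.log s)⁻¹ := by positivity
  have h4 : (Real.log s)⁻¹ ≤ 1 / 2 := by
    rw [one_div]; exact inv_anti₀ two_pos h2
  have h5 : ((Real.log s) ^ 2)⁻¹ = ((Real.log s)⁻¹) ^ 2 := by rw [inv_pow]
  rw [h5]
  apply pow_le_pow_left₀ <;> nlinarith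

lemma half_le_lam {s : ℝ} (hs : Real.exp 2 ≤ s) : 1 / 2 ≤ lam (1 / 2) s := by
  have h1 := one_lt_of hs
  have h2 := two_le_log hs
  unfold lam
  rw [le_div_iff₀ (by linarith), ← Real.sqrt_eq_rpow]
  have h3 : 0 < Real.sqrt s := Real.sqrt_pos.2 (by linarith)
  have := Real.log_le_sub_one_of_pos h3
  rw [Real.log_sqrt (by linarith)] at this
  linarith

lemma inv_log_hasDerivAt {s : ℝ} (hs : 1 < s) :
    HasDerivAt (fun s => -(Real.log s)⁻¹) (s⁻¹ / (Real.log s) ^ 2) s := by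
  have := ((Real.hasDerivAt_log (by linarith : s ≠ 0)).inv (Real.log_pos hs).ne').neg
  refine HasDerivAt.congr_deriv this ?_
  ring

/-! ### The weights -/

noncomputable def psi (z : ℝ) : ℝ := ((1 + z ^ 2) ^ 2)⁻¹
noncomputable def psi' (z : ℝ) : ℝ := -4 * z * ((1 + z ^ 2) ^ 3)⁻¹
noncomputable def phi (z : ℝ) : ℝ := (z * (1 + z ^ 2)⁻¹ + Real.arctan z) / 2

lemma psi_pos (z : ℝ) : 0 < psi z := by unfold psi; positivity

lemma psi_le (z : ℝ) : psi z ≤ (1 + z ^ 2)⁻¹ := by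
  unfold psi
  apply inv_anti₀ (by positivity)
  nlinarith [sq_nonneg z]

lemma psi_le_one (z : ℝ) : psi z ≤ 1 := by
  refine (psi_le z).trans (inv_le_one_of_one_le₀ (by nlinarith [sq_nonneg z]))

lemma sq_mul_psi_le (z : ℝ) : z ^ 2 * psi z ≤ (1 + z ^ 2)⁻¹ := by
  unfold psi
  rw [← div_eq_mul_inv, inv_eq_one_div, div_le_div_iff₀ (by positivity) (by positivity)]
  nlinarith [sq_nonneg z]

lemma abs_mul_psi_le (z : ℝ) : |z| * psi z ≤ 1 := by
  have h1 := sq_mul_psi_le z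
  have h2 := psi_le_one z
  have h3 := psi_pos z
  have h4 : (1 + z ^ 2)⁻¹ ≤ 1 := inv_le_one_of_one_le₀ (by nlinarith [sq_nonneg z])
  have h5 : |z| ≤ (1 + z ^ 2) / 2 := by
    rw [← sq_abs]; nlinarith [sq_nonneg (|z| - 1)]
  nlinarith [mul_le_mul_of_nonneg_right h5 h3.le]

lemma psi_hasDerivAt (z : ℝ) : HasDerivAt psi (psi' z) z := by
  have h1 : (1 + z ^ 2) ≠ 0 := by positivity
  have := ((((hasDerivAt_id z).pow 2).const_add 1).pow 2).inv (pow_ne_zero 2 h1)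
  refine HasDerivAt.congr_deriv this ?_
  simp only [psi', id]
  field_simp
  norm_num
  ring

lemma phi_hasDerivAt (z : ℝ) : HasDerivAt phi (psi z) z := by
  have h1 : (1 + z ^ 2) ≠ 0 := by positivity
  have := (((hasDerivAt_id z).mul ((((hasDerivAt_id z).pow 2).const_add 1).inv h1)).add
    (Real.hasDerivAt_arctan z)).div_const 2
  refine HasDerivAt.congr_deriv this ?_
  simp only [psi, id, Pi.inv_apply, Pi.pow_apply]
  field_simp
  norm_num
  ring

lemma psi'_abs_le (z : ℝ) : |psi' z| ≤ 2 * psi z := by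
  have h1 : 0 < 1 + z ^ 2 := by positivity
  have h5 : |z| ≤ (1 + z ^ 2) / 2 := by
    rw [← sq_abs]; nlinarith [sq_nonneg (|z| - 1)]
  unfold psi' psi
  rw [abs_mul, abs_mul, abs_of_pos (by positivity : 0 < ((1 + z ^ 2) ^ 3)⁻¹)]
  have : ((1 + z ^ 2) ^ 2)⁻¹ = (1 + z ^ 2) * ((1 + z ^ 2) ^ 3)⁻¹ := by
    field_simp
  rw [this]
  have h6 : 0 < ((1 + z ^ 2) ^ 3)⁻¹ := by positivity
  norm_num
  nlinarith [mul_le_mul_of_nonneg_right h5 h6.le]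

lemma phi_abs_le (z : ℝ) : |phi z| ≤ 2 := by
  have h1 : |z * (1 + z ^ 2)⁻¹| ≤ 1 := by
    rw [abs_mul, abs_of_pos (by positivity : 0 < (1 + z ^ 2)⁻¹), ← div_eq_mul_inv,
      div_le_one (by positivity)]
    rw [← sq_abs]; nlinarith [sq_nonneg (|z| - 1)]
  have h2 : |Real.arctan z| ≤ 2 := by
    have := Real.arctan_lt_pi_div_two z
    have := Real.neg_pi_div_two_lt_arctan z
    have := Real.pi_le_four
    rw [abs_le]; constructor <;> linarith
  unfold phi
  rw [abs_div, abs_of_pos (two_pos : (0:ℝ) < 2)]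
  have := abs_add_le (z * (1 + z ^ 2)⁻¹) (Real.arctan z)
  linarith

lemma psi_continuous : Continuous psi :=
  continuous_iff_continuousAt.2 fun z => (psi_hasDerivAt z).continuousAt

lemma psi'_continuous : Continuous psi' := by
  unfold psi'
  refine Continuous.mul (by fun_prop) (Continuous.inv₀ (by fun_prop) fun z => by positivity)

lemma psi_integrable : Integrable psi :=
  integrable_inv_one_add_sq.mono' psi_continuous.aestronglyMeasurable
    (ae_of_all _ fun z => by rw [Real.norm_eq_abs, abs_of_pos (psi_pos z)]; exact psi_le z)

lemma sq_psi_integrable : Integrable fun z => z ^ 2 * psi z :=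
  integrable_inv_one_add_sq.mono' (by have := psi_continuous; fun_prop)
    (ae_of_all _ fun z => by
      rw [Real.norm_eq_abs, abs_of_nonneg (mul_nonneg (sq_nonneg _) (psi_pos z).le)]
      exact sq_mul_psi_le z)

structure IsWeight (w w' : ℝ → ℝ) : Prop where
  d : ∀ z, HasDerivAt w (w' z) z
  c : Continuous w'
  b0 : ∀ z, |w z| ≤ 2
  b1 : ∀ z, |w' z| ≤ 2 * psi z

lemma IsWeight.cont {w w' : ℝ → ℝ} (h : IsWeight w w') : Continuous w :=
  continuous_iff_continuousAt.2 fun z => (h.d z).continuousAt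

lemma weight_psi : IsWeight psi psi' := by
  refine ⟨psi_hasDerivAt, psi'_continuous, fun z => ?_, psi'_abs_le⟩
  rw [abs_of_pos (psi_pos z)]; linarith [psi_le_one z]

lemma weight_phi : IsWeight phi psi := by
  refine ⟨phi_hasDerivAt, psi_continuous, phi_abs_le, fun z => ?_⟩
  rw [abs_of_pos (psi_pos z)]; linarith [psi_pos z]

lemma IsWeight.b2 {w w' : ℝ → ℝ} (h : IsWeight w w') (z : ℝ) : |z * w' z| ≤ 2 := by
  rw [abs_mul]
  have := mul_le_mul_of_nonneg_left (h.b1 z) (abs_nonneg z)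
  nlinarith [abs_mul_psi_le z]

lemma IsWeight.b3 {w w' : ℝ → ℝ} (h : IsWeight w w') (z : ℝ) : |w' z| ≤ 2 :=
  (h.b1 z).trans (by linarith [psi_le_one z])

/-! ### The virial identity -/

/-- weighted mass -/
noncomputable def wmass (w : ℝ → ℝ) (u : ℝ → ℝ → ℝ) (s : ℝ) : ℝ :=
  ∫ x, w (x / lam (1 / 2) s) * u s x

/-- time derivative of the weighted mass -/
noncomputable def wrate (b : ℝ) (w' : ℝ → ℝ) (u : ℝ → ℝ → ℝ) (s : ℝ) : ℝ :=
  (lam (1 / 2) s)⁻¹ * (∫ x, w' (x / lam (1 / 2) s) * flux b u s x)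
    - (lamD s / lam (1 / 2) s) * ∫ x, (x / lam (1 / 2) s * w' (x / lam (1 / 2) s)) * u s x

lemma integrable_bdd_mul {g f : ℝ → ℝ} {C : ℝ} (hf : Integrable f) (hg : Continuous g)
    (hb : ∀ x, |g x| ≤ C) : Integrable fun x => g x * f x :=
  hf.bdd_mul hg.aestronglyMeasurable (ae_of_all _ hb)

lemma virial {b : ℝ} (hb : b ∈ Set.Ioo (0 : ℝ) 3) {u : ℝ → ℝ → ℝ}
    (hu : IsH2NonnegMomentumSolution b u) {w w' : ℝ → ℝ} (hw : IsWeight w w')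
    {t₁ t₂ : ℝ} (h1 : 1 < t₁) (h12 : t₁ ≤ t₂) :
    IntervalIntegrable (wrate b w' u) volume t₁ t₂ ∧
    ∫ s in t₁..t₂, wrate b w' u s = wmass w u t₂ - wmass w u t₁ := by
  have hwc := hw.cont
  have hwc' := hw.c
  set l := lam (1 / 2) with hl
  set M := ∫ y, mom u 0 y with hM
  have hgt : ∀ s ∈ Set.uIcc t₁ t₂, 1 < s := fun s hs => by
    rw [Set.uIcc_of_le h12] at hs; exact h1.trans_le hs.1
  have hgt' : ∀ s ∈ Set.uIoc t₁ t₂, 1 < s := fun s hs => hgt s (Set.uIoc_subset_uIcc hs)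
  have hsub : Set.uIoc t₁ t₂ ⊆ Set.Ioi 1 := hgt'
  have ut : ∀ s x, HasDerivAt (fun s => u s x) (deriv (fun s => u s x) s) s := fun s x =>
    ((hu.1 x).differentiable (by norm_num) s).hasDerivAt
  have hcu := hu.2.2.1
  have hcut := hu.2.2.2.1
  have heq : ∀ s x, 0 < s → deriv (fun s => u s x) s = - deriv (flux b u s) x := fun s x hs => by
    have := hu.2.2.2.2.2.2.2.2.1 s x hs
    linarith
  have hI := fun s hs => (hu.2.2.2.2.2.2.2.2.2.1 s hs).1
  set h : ℝ → ℝ → ℝ := fun s x => w (x / l s) * deriv (fun s => u s x) s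
    - (lamD s / l s) * ((x / l s * w' (x / l s)) * u s x) with hh
  -- pointwise in time
  have hder : ∀ x, ∀ s, 1 < s → HasDerivAt (fun s => w (x / l s) * u s x) (h s x) s := by
    intro x s hs
    have e1 : HasDerivAt (fun s => x / l s) (-(x * lamD s) / (l s) ^ 2) s := by
      have := (hasDerivAt_const s x).div (lam_hasDerivAt hs) (lam_pos hs).ne'
      refine HasDerivAt.congr_deriv this ?_
      simp only [hl]; ring
    have e2 := ((hw.d (x / l s)).comp s e1).mul (ut s x)
    refine HasDerivAt.congr_deriv e2 ?_
    have hl0 : l s ≠ 0 := (lam_pos hs).ne'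
    simp only [hh, Function.comp]
    field_simp
    ring
  have hlc : ContinuousOn l (Set.Ioi 1) := lam_continuousOn
  have hfst : Set.MapsTo (Prod.fst : ℝ × ℝ → ℝ) (Set.Ioi 1 ×ˢ Set.univ) (Set.Ioi 1) :=
    fun p hp => hp.1
  have hz : ContinuousOn (fun p : ℝ × ℝ => p.2 / l p.1) (Set.Ioi 1 ×ˢ Set.univ) :=
    continuousOn_snd.div (hlc.comp continuousOn_fst hfst) fun p hp => (lam_pos hp.1).ne'
  have hq : ContinuousOn (fun s => lamD s / l s) (Set.Ioi 1) :=
    lamD_continuousOn.div hlc fun s hs => (lam_pos hs).ne'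
  have hhc : ContinuousOn (Function.uncurry h) (Set.Ioi 1 ×ˢ Set.univ) := by
    refine ContinuousOn.sub ((hwc.comp_continuousOn hz).mul hcut.continuousOn) ?_
    exact (hq.comp continuousOn_fst hfst).mul
      ((hz.mul (hwc'.comp_continuousOn hz)).mul hcu.continuousOn)
  have hcomp : IsCompact (Set.uIcc t₁ t₂) := isCompact_uIcc
  obtain ⟨B, hB⟩ := hcomp.exists_bound_of_continuousOn (hq.mono hgt)
  -- slice integrability
  have int1 : ∀ s, 1 < s → Integrable (fun x => w (x / l s) * deriv (flux b u s) x) := fun s hs =>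
    integrable_bdd_mul (C := 2) (flux_facts hb hu (by linarith)).2.2.1 (by fun_prop)
      fun x => hw.b0 _
  have int2 : ∀ s, 1 < s → Integrable (fun x => (x / l s * w' (x / l s)) * u s x) := fun s hs =>
    integrable_bdd_mul (C := 2) (hI s (by linarith)) (by fun_prop) fun x => hw.b2 _
  have int3 : ∀ s, 1 < s → Integrable (fun x => w' (x / l s) * flux b u s x) := fun s hs =>
    integrable_bdd_mul (C := 2) (flux_facts hb hu (by linarith)).2.1 (by fun_prop) fun x => hw.b3 _
  have int4 : ∀ s, 1 < s → Integrable (fun x => w (x / l s) * flux b u s x) := fun s hs =>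
    integrable_bdd_mul (C := 2) (flux_facts hb hu (by linarith)).2.1 (by fun_prop) fun x => hw.b0 _
  have int5 : ∀ s, 1 < s → Integrable (fun x => w (x / l s) * u s x) := fun s hs =>
    integrable_bdd_mul (C := 2) (hI s (by linarith)) (by fun_prop) fun x => hw.b0 _
  have hs_eq : ∀ s, 1 < s → h s = fun x => -(w (x / l s) * deriv (flux b u s) x)
      - (lamD s / l s) * ((x / l s * w' (x / l s)) * u s x) := by
    intro s hs
    ext x
    simp only [hh, heq s x (by linarith)]
    ring
  have hslice : ∀ s, 1 < s → Integrable (h s) := by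
    intro s hs
    rw [hs_eq s hs]
    exact (int1 s hs).neg.sub ((int2 s hs).const_mul _)
  have hint : ∀ s, 1 < s → ∫ x, h s x = wrate b w' u s := by
    intro s hs
    have hl0 : l s ≠ 0 := (lam_pos hs).ne'
    have i1n : Integrable (fun x => -(w (x / l s) * deriv (flux b u s) x)) := (int1 s hs).neg
    rw [hs_eq s hs, integral_sub i1n ((int2 s hs).const_mul _), integral_neg,
      integral_const_mul]
    have ibp := integral_mul_deriv_eq_deriv_mul_of_integrable
      (u := fun x => w (x / l s)) (u' := fun x => (l s)⁻¹ * w' (x / l s))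
      (v := flux b u s) (v' := deriv (flux b u s))
      (fun x _ => by
        have := (hw.d (x / l s)).comp x ((hasDerivAt_id x).div_const (l s))
        refine HasDerivAt.congr_deriv this ?_
        simp; ring)
      (fun x _ => ((flux_facts hb hu (by linarith)).1 x).hasDerivAt)
      (int1 s hs) (by
        have := (int3 s hs).const_mul (l s)⁻¹
        refine this.congr (ae_of_all _ fun x => ?_)
        simp [mul_assoc]) (int4 s hs)
    rw [ibp]
    simp_rw [mul_assoc (l s)⁻¹]
    rw [integral_const_mul, neg_neg]
    rfl
  have hbound : ∀ s ∈ Set.uIoc t₁ t₂, ∫ x, ‖h s x‖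
      ≤ 2 * ((1 + (3 / 2) * kmass) * M ^ 2) + B * (2 * M) := by
    intro s hs
    have hs1 := hgt' s hs
    have hs0 : 0 ≤ s := by linarith
    obtain ⟨-, -, fi, -, fb⟩ := flux_facts hb hu hs0
    obtain ⟨ux, -, um⟩ := sol_facts hb hu hs0
    have u0 : ∀ x, 0 ≤ u s x := fun x => (abs_nonneg _).trans (ux x)
    have hBs : |lamD s / l s| ≤ B := hB s (Set.uIoc_subset_uIcc hs)
    have hB0 : 0 ≤ B := (abs_nonneg _).trans hBs
    calc ∫ x, ‖h s x‖ ≤ ∫ x, (2 * |deriv (flux b u s) x| + B * (2 * u s x)) := by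
          refine integral_mono (hslice s hs1).norm
            ((fi.abs.const_mul 2).add (((hI s hs0).const_mul 2).const_mul B)) fun x => ?_
          rw [hs_eq s hs1]
          simp only [Real.norm_eq_abs]
          refine (abs_sub _ _).trans (add_le_add ?_ ?_)
          · rw [abs_neg, abs_mul]
            exact mul_le_mul_of_nonneg_right (hw.b0 _) (abs_nonneg _)
          · rw [abs_mul, abs_mul _ (u s x), abs_of_nonneg (u0 x)]
            exact mul_le_mul hBs (mul_le_mul_of_nonneg_right (hw.b2 _) (u0 x))
              (mul_nonneg (abs_nonneg _) (u0 x)) hB0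
      _ = 2 * (∫ x, |deriv (flux b u s) x|) + B * (2 * M) := by
          rw [integral_add (fi.abs.const_mul 2) (((hI s hs0).const_mul 2).const_mul B),
            integral_const_mul, integral_const_mul, integral_const_mul, um]
      _ ≤ _ := by linarith
  have hmeas : AEStronglyMeasurable (Function.uncurry h)
      ((volume.restrict (Set.uIoc t₁ t₂)).prod (volume : Measure ℝ)) := by
    have : (volume.restrict (Set.uIoc t₁ t₂)).prod (volume : Measure ℝ)
        = ((volume : Measure ℝ).prod (volume : Measure ℝ)).restrict
          (Set.uIoc t₁ t₂ ×ˢ Set.univ) := by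
      rw [← Measure.prod_restrict, Measure.restrict_univ]
    rw [this]
    exact (hhc.mono (Set.prod_mono hsub subset_rfl)).aestronglyMeasurable
      (measurableSet_uIoc.prod MeasurableSet.univ)
  have hprod : Integrable (Function.uncurry h)
      ((volume.restrict (Set.uIoc t₁ t₂)).prod (volume : Measure ℝ)) := by
    rw [integrable_prod_iff hmeas]
    constructor
    · exact (ae_restrict_iff' measurableSet_uIoc).2 (ae_of_all _ fun s hs => hslice s (hgt' s hs))
    · refine Integrable.mono' (g := fun _ => 2 * ((1 + (3 / 2) * kmass) * M ^ 2) + B * (2 * M))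
        ?_ hmeas.norm.integral_prod_right' ?_
      · exact (integrableOn_const (by simp [Set.uIoc]))
      · refine (ae_restrict_iff' measurableSet_uIoc).2 (ae_of_all _ fun s hs => ?_)
        rw [Real.norm_eq_abs, abs_of_nonneg (integral_nonneg fun x => norm_nonneg _)]
        exact hbound s hs
  have hII : IntegrableOn (wrate b w' u) (Set.uIoc t₁ t₂) := by
    refine (hprod.integral_prod_left).congr ?_
    refine (ae_restrict_iff' measurableSet_uIoc).2 (ae_of_all _ fun s hs => ?_)
    exact hint s (hgt' s hs)
  refine ⟨intervalIntegrable_iff.2 hII, ?_⟩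
  have e1 : ∫ s in t₁..t₂, wrate b w' u s = ∫ s in t₁..t₂, ∫ x, h s x :=
    intervalIntegral.integral_congr fun s hs => (hint s (hgt s hs)).symm
  rw [e1, intervalIntegral_integral_swap hprod]
  unfold wmass
  rw [← integral_sub (int5 t₂ (by linarith)) (int5 t₁ h1)]
  refine integral_congr_ae (ae_of_all _ fun x => ?_)
  refine intervalIntegral.integral_eq_sub_of_hasDerivAt (f := fun s => w (x / l s) * u s x)
    (fun s hs => hder x s (hgt s hs)) ?_
  apply ContinuousOn.intervalIntegrable
  have : ContinuousOn (fun s : ℝ => (s, x)) (Set.uIcc t₁ t₂) := by fun_prop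
  exact hhc.comp this fun s hs => ⟨hgt s hs, Set.mem_univ _⟩

/-! ### Estimates -/

/-- weighted flux -/
noncomputable def aflux (b : ℝ) (u : ℝ → ℝ → ℝ) (s : ℝ) : ℝ :=
  (lam (1 / 2) s)⁻¹ * ∫ x, psi (x / lam (1 / 2) s) * flux b u s x

/-- second moment of the weight -/
noncomputable def C0 : ℝ := ∫ z, z ^ 2 * psi z

noncomputable def C1 : ℝ := (∫ z, psi z) + 1

lemma C0_nonneg : 0 ≤ C0 := integral_nonneg fun z => mul_nonneg (sq_nonneg _) (psi_pos z).le

lemma C1_pos : 0 < C1 := by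
  have : 0 ≤ ∫ z, psi z := integral_nonneg fun z => (psi_pos z).le
  unfold C1; linarith

lemma estimates {b : ℝ} (hb : b ∈ Set.Ioo (0 : ℝ) 3) {u : ℝ → ℝ → ℝ}
    (hu : IsH2NonnegMomentumSolution b u) {s : ℝ} (hs : Real.exp 2 ≤ s) :
    |wrate b psi' u s| ≤ 6 * wrate b psi u s + 8 * C0 * (s⁻¹ / (Real.log s) ^ 2) ∧
    (wmass psi u s) ^ 2 * (s⁻¹ / (4 * C1)) ≤ wrate b psi u s + C0 * (s⁻¹ / (Real.log s) ^ 2) := by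
  have hs1 := one_lt_of hs
  have hs0 : 0 ≤ s := by linarith
  have hl0 : 0 < lam (1 / 2) s := lam_pos hs1
  have hlsq := lam_sq hs1
  have hd := lamD_nonneg hs
  have hdsq := lamD_sq_le hs
  have hlog := two_le_log hs
  obtain ⟨-, fi, -, fu, -⟩ := flux_facts hb hu hs0
  obtain ⟨ux, -, um⟩ := sol_facts hb hu hs0
  have u0 : ∀ x, 0 ≤ u s x := fun x => (abs_nonneg _).trans (ux x)
  have iu := (hu.2.2.2.2.2.2.2.2.2.1 s hs0).1
  have iuu := (hu.2.2.2.2.2.2.2.2.2.1 s hs0).2.1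
  have f0 : ∀ x, 0 ≤ flux b u s x := fun x => le_trans (by positivity) (fu x)
  set l := lam (1 / 2) s with hl
  have pc := psi_continuous
  have pc' := psi'_continuous
  have babs : ∀ x, |psi x| ≤ 1 := fun x => by
    rw [abs_of_pos (psi_pos x)]; exact psi_le_one x
  have j1 : Integrable fun x => psi (x / l) * flux b u s x :=
    integrable_bdd_mul fi (by fun_prop) fun x => babs _
  have j2 : Integrable fun x => psi (x / l) * (u s x) ^ 2 :=
    integrable_bdd_mul iuu (by fun_prop) fun x => babs _
  have j3 : Integrable fun x => psi (x / l) * u s x :=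
    integrable_bdd_mul iu (by fun_prop) fun x => babs _
  have j4 : Integrable fun x => (|x / l| * psi (x / l)) * u s x :=
    integrable_bdd_mul (C := 1) iu (by fun_prop) fun x => by
      rw [abs_of_nonneg (mul_nonneg (abs_nonneg _) (psi_pos _).le)]; exact abs_mul_psi_le _
  have j5 : Integrable fun x => (x / l) ^ 2 * psi (x / l) := sq_psi_integrable.comp_div hl0.ne'
  have j6 : Integrable fun x => psi (x / l) := psi_integrable.comp_div hl0.ne'
  have v5 : ∫ x, (x / l) ^ 2 * psi (x / l) = l * C0 := by
    have := Measure.integral_comp_div (fun z => z ^ 2 * psi z) l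
    rw [this, abs_of_pos hl0]; rfl
  have v6 : ∫ x, psi (x / l) ≤ l * C1 := by
    have := Measure.integral_comp_div (fun z => psi z) l
    rw [this, abs_of_pos hl0, smul_eq_mul]
    exact mul_le_mul_of_nonneg_left (by unfold C1; linarith) hl0.le
  set Q := ∫ x, psi (x / l) * (u s x) ^ 2 with hQ
  set A := aflux b u s with hA
  set E := lamD s / l * ∫ x, (|x / l| * psi (x / l)) * u s x with hE
  set R := s⁻¹ / (Real.log s) ^ 2 with hR
  have hAe : ∫ x, psi (x / l) * flux b u s x = l * A := by
    rw [hA, aflux, ← hl, ← mul_assoc, mul_inv_cancel₀ hl0.ne', one_mul]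
  have hQA : Q ≤ 2 * (l * A) := by
    rw [← hAe, hQ, ← integral_const_mul]
    refine integral_mono j2 (j1.const_mul 2) fun x => ?_
    have := mul_le_mul_of_nonneg_left (fu x) (psi_pos (x / l)).le
    simp only
    linarith
  have hA0 : 0 ≤ A := by
    have : 0 ≤ l * A := by
      rw [← hAe]; exact integral_nonneg fun x => mul_nonneg (psi_pos _).le (f0 x)
    exact nonneg_of_mul_nonneg_right this hl0
  have hEle : E ≤ A / 2 + C0 * R := by
    have h1 : E ≤ (4 * l)⁻¹ * Q + l * (lamD s / l) ^ 2 * (l * C0) := by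
      rw [hE, hQ, ← v5, ← integral_const_mul, ← integral_const_mul, ← integral_const_mul,
        ← integral_add (j2.const_mul _) (j5.const_mul _)]
      refine integral_mono (j4.const_mul _) ((j2.const_mul _).add (j5.const_mul _)) fun x => ?_
      simp only
      have hp := (psi_pos (x / l)).le
      rw [← sq_abs (x / l)]
      generalize |x / l| = z at *
      generalize psi (x / l) = p at *
      generalize lamD s / l = q at *
      have : (4 * l)⁻¹ * (p * u s x ^ 2) + l * q ^ 2 * (z ^ 2 * p) - q * (z * p * u s x)
          = (4 * l)⁻¹ * p * (u s x - 2 * l * q * z) ^ 2 := by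
        field_simp
        ring
      have h2 : 0 ≤ (4 * l)⁻¹ * p * (u s x - 2 * l * q * z) ^ 2 := by positivity
      linarith
    have h2 : (4 * l)⁻¹ * Q ≤ A / 2 := by
      rw [inv_mul_le_iff₀ (by positivity)]
      linarith
    have h3 : l * (lamD s / l) ^ 2 * (l * C0) = C0 * (lamD s) ^ 2 := by
      field_simp
    have h4 := mul_le_mul_of_nonneg_left hdsq C0_nonneg
    linarith
  have hq0 : 0 ≤ lamD s / l := div_nonneg hd hl0.le
  have hr1 : A - E ≤ wrate b psi u s := by
    have : (lamD s / l) * ∫ x, (x / l * psi (x / l)) * u s x ≤ E := by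
      refine mul_le_mul_of_nonneg_left ?_ hq0
      refine integral_mono (integrable_bdd_mul (C := 2) iu (by fun_prop) fun x =>
        weight_phi.b2 _) j4 fun x => ?_
      exact mul_le_mul_of_nonneg_right (mul_le_mul_of_nonneg_right (le_abs_self _) (psi_pos _).le)
        (u0 x)
    have e : wrate b psi u s = A - (lamD s / l) * ∫ x, (x / l * psi (x / l)) * u s x := rfl
    linarith
  have hr2 : |wrate b psi' u s| ≤ 2 * A + 2 * E := by
    refine (abs_sub _ _).trans (add_le_add ?_ ?_)
    · rw [← hl, abs_mul, abs_of_pos (inv_pos.2 hl0), inv_mul_le_iff₀ hl0]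
      have : l * (2 * A) = ∫ x, 2 * (psi (x / l) * flux b u s x) := by
        rw [integral_const_mul, hAe]; ring
      rw [this]
      rw [← Real.norm_eq_abs]
      refine norm_integral_le_of_norm_le (j1.const_mul 2) (ae_of_all _ fun x => ?_)
      rw [norm_mul, Real.norm_eq_abs, Real.norm_eq_abs, abs_of_nonneg (f0 x), ← mul_assoc]
      exact mul_le_mul_of_nonneg_right (psi'_abs_le _) (f0 x)
    · rw [← hl, abs_mul, abs_of_nonneg hq0]
      have : 2 * E = (lamD s / l) * ∫ x, 2 * ((|x / l| * psi (x / l)) * u s x) := by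
        rw [integral_const_mul, hE]; ring
      rw [this]
      refine mul_le_mul_of_nonneg_left ?_ hq0
      rw [← Real.norm_eq_abs]
      refine norm_integral_le_of_norm_le (j4.const_mul 2) (ae_of_all _ fun x => ?_)
      rw [norm_mul, norm_mul, Real.norm_eq_abs, Real.norm_eq_abs, Real.norm_eq_abs,
        abs_of_nonneg (u0 x), ← mul_assoc]
      refine mul_le_mul_of_nonneg_right ?_ (u0 x)
      have := mul_le_mul_of_nonneg_left (psi'_abs_le (x / l)) (abs_nonneg (x / l))
      linarith
  refine ⟨by linarith, ?_⟩
  -- Cauchy-Schwarz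
  set J := wmass psi u s with hJ
  have hJe : J = ∫ x, psi (x / l) * u s x := rfl
  have hC := C1_pos
  have hcs : J ^ 2 ≤ l * C1 * Q := by
    set k := J / (l * C1) with hk
    have h1 : 0 ≤ ∫ x, (psi (x / l) * (u s x) ^ 2 - 2 * k * (psi (x / l) * u s x)
        + k ^ 2 * psi (x / l)) := by
      refine integral_nonneg fun x => ?_
      have : 0 ≤ psi (x / l) * (u s x - k) ^ 2 := mul_nonneg (psi_pos _).le (sq_nonneg _)
      simp only [Pi.zero_apply]
      linarith
    have jd : Integrable fun x => psi (x / l) * (u s x) ^ 2 - 2 * k * (psi (x / l) * u s x) :=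
      j2.sub (j3.const_mul _)
    rw [integral_add jd (j6.const_mul _), integral_sub j2 (j3.const_mul _),
      integral_const_mul, integral_const_mul, ← hJe, ← hQ] at h1
    have h2 := mul_le_mul_of_nonneg_left v6 (sq_nonneg k)
    have h3 : k * (l * C1) = J := div_mul_cancel₀ _ (by positivity)
    have h4 : k ^ 2 * (l * C1) = k * J := by rw [sq, mul_assoc, h3]
    have h5 : k * J ≤ Q := by linarith
    have h6 := mul_le_mul_of_nonneg_left h5 (by positivity : 0 ≤ l * C1)
    have h7 : l * C1 * (k * J) = J ^ 2 := by rw [← mul_assoc, mul_comm (l * C1), h3, sq]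
    linarith
  have h8 : J ^ 2 ≤ 2 * C1 * A * s := by
    have h9 : J ^ 2 ≤ 2 * C1 * A * l ^ 2 := by
      have := mul_le_mul_of_nonneg_left hQA (by positivity : 0 ≤ l * C1)
      nlinarith
    have h10 : l ^ 2 ≤ s := by
      rw [hlsq]
      exact div_le_self hs0 (by nlinarith)
    exact h9.trans (mul_le_mul_of_nonneg_left h10 (by positivity))
  have h11 : J ^ 2 * (s⁻¹ / (4 * C1)) ≤ A / 2 := by
    have hsp : 0 < s := by linarith
    have : s⁻¹ / (4 * C1) = (4 * C1 * s)⁻¹ := by field_simp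
    rw [this, ← div_eq_mul_inv, div_le_iff₀ (by positivity)]
    linarith
  linarith

/-! ### Conclusion -/

lemma wmass_abs_le {b : ℝ} (hb : b ∈ Set.Ioo (0 : ℝ) 3) {u : ℝ → ℝ → ℝ}
    (hu : IsH2NonnegMomentumSolution b u) {w w' : ℝ → ℝ} (hw : IsWeight w w')
    {s : ℝ} (hs : 0 ≤ s) : |wmass w u s| ≤ 2 * ∫ y, mom u 0 y := by
  obtain ⟨ux, -, um⟩ := sol_facts hb hu hs
  have u0 : ∀ x, 0 ≤ u s x := fun x => (abs_nonneg _).trans (ux x)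
  have iu := (hu.2.2.2.2.2.2.2.2.2.1 s hs).1
  rw [← um, ← integral_const_mul, ← Real.norm_eq_abs]
  refine norm_integral_le_of_norm_le (iu.const_mul 2) (ae_of_all _ fun x => ?_)
  rw [norm_mul, Real.norm_eq_abs, Real.norm_eq_abs, abs_of_nonneg (u0 x)]
  exact mul_le_mul_of_nonneg_right (hw.b0 _) (u0 x)

lemma invlog_int {t₁ t₂ : ℝ} (h1 : Real.exp 2 ≤ t₁) (h12 : t₁ ≤ t₂) :
    IntervalIntegrable (fun s => s⁻¹ / (Real.log s) ^ 2) volume t₁ t₂ ∧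
    ∫ s in t₁..t₂, s⁻¹ / (Real.log s) ^ 2 = (Real.log t₁)⁻¹ - (Real.log t₂)⁻¹ := by
  have hgt : ∀ s ∈ Set.uIcc t₁ t₂, 1 < s := fun s hs => by
    rw [Set.uIcc_of_le h12] at hs; exact one_lt_of (h1.trans hs.1)
  have hne : ∀ s ∈ Set.uIcc t₁ t₂, s ≠ 0 := fun s hs => by linarith [hgt s hs]
  have hi : IntervalIntegrable (fun s => s⁻¹ / (Real.log s) ^ 2) volume t₁ t₂ := by
    apply ContinuousOn.intervalIntegrable
    refine ContinuousOn.div (continuousOn_id.inv₀ hne) ((continuousOn_id.log hne).pow 2) ?_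
    intro s hs
    exact pow_ne_zero _ (Real.log_pos (hgt s hs)).ne'
  refine ⟨hi, ?_⟩
  rw [intervalIntegral.integral_eq_sub_of_hasDerivAt (fun s hs => inv_log_hasDerivAt (hgt s hs)) hi]
  ring

lemma tendsto_of_mono_bdd {P : ℝ → ℝ} {T B : ℝ} (hm : MonotoneOn P (Set.Ici T))
    (hB : ∀ t, T ≤ t → P t ≤ B) : ∃ c, Tendsto P atTop (nhds c) := by
  have hm' : Monotone fun t => P (max t T) := fun a c hac =>
    hm (Set.mem_Ici.2 (le_max_right _ _)) (Set.mem_Ici.2 (le_max_right _ _)) (max_le_max hac le_rfl)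
  have hb : BddAbove (Set.range fun t => P (max t T)) :=
    ⟨B, by rintro _ ⟨t, rfl⟩; exact hB _ (le_max_right _ _)⟩
  refine ⟨_, (tendsto_atTop_ciSup hm' hb).congr' ?_⟩
  filter_upwards [eventually_ge_atTop T] with t ht
  rw [max_eq_left ht]

lemma wmass_psi_tendsto {b : ℝ} (hb : b ∈ Set.Ioo (0 : ℝ) 3) {u : ℝ → ℝ → ℝ}
    (hu : IsH2NonnegMomentumSolution b u) : Tendsto (wmass psi u) atTop (nhds 0) := by
  set M := ∫ y, mom u 0 y with hM
  have hc0 := C0_nonneg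
  have hc1 := C1_pos
  have hpos : ∀ t, Real.exp 2 ≤ t → 0 ≤ t := fun t ht => by linarith [one_lt_of ht]
  have hJb : ∀ t, Real.exp 2 ≤ t → |wmass psi u t| ≤ 2 * M := fun t ht =>
    wmass_abs_le hb hu weight_psi (hpos t ht)
  have hIb : ∀ t, Real.exp 2 ≤ t → |wmass phi u t| ≤ 2 * M := fun t ht =>
    wmass_abs_le hb hu weight_phi (hpos t ht)
  have hlb : ∀ t, Real.exp 2 ≤ t → 0 ≤ (Real.log t)⁻¹ := fun t ht =>
    inv_nonneg.2 (by linarith [two_le_log ht])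
  have hlb1 : ∀ t, Real.exp 2 ≤ t → (Real.log t)⁻¹ ≤ 1 := fun t ht =>
    inv_le_one_of_one_le₀ (by linarith [two_le_log ht])
  set P : ℝ → ℝ := fun t => 6 * wmass phi u t - 8 * C0 * (Real.log t)⁻¹ with hP
  have key : ∀ t₁ t₂, Real.exp 2 ≤ t₁ → t₁ ≤ t₂ →
      |wmass psi u t₂ - wmass psi u t₁| ≤ P t₂ - P t₁ := by
    intro t₁ t₂ h1 h12
    obtain ⟨a1, a2⟩ := virial hb hu weight_psi (one_lt_of h1) h12
    obtain ⟨b1, b2⟩ := virial hb hu weight_phi (one_lt_of h1) h12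
    obtain ⟨c1, c2⟩ := invlog_int h1 h12
    rw [← a2, ← Real.norm_eq_abs]
    have e : P t₂ - P t₁ = ∫ s in t₁..t₂,
        (6 * wrate b psi u s + 8 * C0 * (s⁻¹ / (Real.log s) ^ 2)) := by
      rw [intervalIntegral.integral_add (b1.const_mul 6) (c1.const_mul (8 * C0)),
        intervalIntegral.integral_const_mul, intervalIntegral.integral_const_mul, b2, c2]
      simp only [hP]
      ring
    rw [e]
    refine intervalIntegral.norm_integral_le_of_norm_le h12 (ae_of_all _ fun s hs => ?_)
      ((b1.const_mul 6).add (c1.const_mul (8 * C0)))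
    exact (estimates hb hu (h1.trans hs.1.le)).1
  obtain ⟨p, hp⟩ : ∃ c, Tendsto P atTop (nhds c) := by
    refine tendsto_of_mono_bdd (T := Real.exp 2) (B := 12 * M) ?_ ?_
    · intro t₁ h1 t₂ h2 h12
      have := (abs_nonneg _).trans (key t₁ t₂ h1 h12)
      linarith
    · intro t ht
      have := (le_abs_self _).trans (hIb t ht)
      have := mul_nonneg hc0 (hlb t ht)
      simp only [hP]; linarith
  obtain ⟨q, hq⟩ : ∃ c, Tendsto (fun t => wmass psi u t + P t) atTop (nhds c) := by
    refine tendsto_of_mono_bdd (T := Real.exp 2) (B := 14 * M) ?_ ?_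
    · intro t₁ h1 t₂ h2 h12
      have := (neg_abs_le _).trans' (neg_le_neg (key t₁ t₂ h1 h12))
      simp only
      linarith
    · intro t ht
      have := (le_abs_self _).trans (hIb t ht)
      have := (le_abs_self _).trans (hJb t ht)
      have := mul_nonneg hc0 (hlb t ht)
      simp only [hP]; linarith
  have hJ : Tendsto (wmass psi u) atTop (nhds (q - p)) := by
    have := hq.sub hp
    simpa using this
  set j := q - p with hj
  rcases eq_or_ne j 0 with h0 | h0
  · rwa [h0] at hJ
  exfalso
  have hj2 : 0 < j ^ 2 := by positivity
  have hev : ∀ᶠ t in atTop, j ^ 2 / 2 < (wmass psi u t) ^ 2 :=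
    (hJ.pow 2).eventually_const_lt (by linarith)
  obtain ⟨T0, hT0⟩ := eventually_atTop.1 hev
  set T := max T0 (Real.exp 2) with hT
  have hTe : Real.exp 2 ≤ T := le_max_right _ _
  set κ := j ^ 2 / 2 / (4 * C1) with hκ
  have hκ0 : 0 < κ := by positivity
  have hbd : ∀ t, T ≤ t → κ * (Real.log t - Real.log T) ≤ 4 * M + C0 := by
    intro t ht
    have hTpos : 0 < T := by linarith [one_lt_of hTe]
    obtain ⟨b1, b2⟩ := virial hb hu weight_phi (one_lt_of hTe) ht
    obtain ⟨c1, c2⟩ := invlog_int hTe ht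
    have hgt : ∀ s ∈ Set.uIcc T t, s ≠ 0 := fun s hs => by
      rw [Set.uIcc_of_le ht] at hs; linarith [hs.1]
    have i1 : IntervalIntegrable (fun s : ℝ => s⁻¹) volume T t :=
      (continuousOn_id.inv₀ hgt).intervalIntegrable
    have e1 : ∫ s in T..t, κ * s⁻¹ = κ * (Real.log t - Real.log T) := by
      rw [intervalIntegral.integral_const_mul,
        intervalIntegral.integral_eq_sub_of_hasDerivAt
          (fun s hs => Real.hasDerivAt_log (hgt s hs)) i1]
    have e2 : ∫ s in T..t, (wrate b psi u s + C0 * (s⁻¹ / (Real.log s) ^ 2))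
        = wmass phi u t - wmass phi u T + C0 * ((Real.log T)⁻¹ - (Real.log t)⁻¹) := by
      rw [intervalIntegral.integral_add b1 (c1.const_mul C0),
        intervalIntegral.integral_const_mul, b2, c2]
    have h3 : ∫ s in T..t, κ * s⁻¹
        ≤ ∫ s in T..t, (wrate b psi u s + C0 * (s⁻¹ / (Real.log s) ^ 2)) := by
      refine intervalIntegral.integral_mono_on ht (i1.const_mul κ) (b1.add (c1.const_mul C0))
        fun s hs => ?_
      have hse : Real.exp 2 ≤ s := hTe.trans hs.1
      refine le_trans ?_ (estimates hb hu hse).2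
      have hs0 : 0 < s := by linarith [one_lt_of hse]
      have h4 := (hT0 s ((le_max_left _ _).trans hs.1)).le
      have h5 := mul_le_mul_of_nonneg_right h4 (by positivity : 0 ≤ s⁻¹ / (4 * C1))
      refine le_trans (le_of_eq ?_) h5
      rw [hκ]; ring
    rw [e1, e2] at h3
    have hte := hTe.trans ht
    have h6 := (le_abs_self _).trans (hIb t hte)
    have h7 := (neg_abs_le _).trans' (neg_le_neg (hIb T hTe))
    have h8 : C0 * ((Real.log T)⁻¹ - (Real.log t)⁻¹) ≤ C0 * 1 :=
      mul_le_mul_of_nonneg_left (by linarith [hlb t hte, hlb1 T hTe]) hc0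
    linarith
  have hlim : Tendsto (fun t => κ * (Real.log t - Real.log T)) atTop atTop :=
    (tendsto_atTop_add_const_right _ _ Real.tendsto_log_atTop).const_mul_atTop hκ0
  obtain ⟨t, ht1, ht2⟩ := ((hlim.eventually_gt_atTop (4 * M + C0)).and
    (eventually_ge_atTop T)).exists
  linarith [hbd t ht2]

lemma quarter_le_psi {z : ℝ} (h : |z| ≤ 1) : 1 ≤ 4 * psi z := by
  have h1 : z ^ 2 ≤ 1 := by rw [← sq_abs]; nlinarith [abs_nonneg z]
  unfold psi
  rw [← div_eq_mul_inv, le_div_iff₀ (by positivity)]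
  nlinarith [sq_nonneg z]

/-- A nonnegative function has local mass controlled by its weighted mass. -/
lemma local_le {f : ℝ → ℝ} (hf : Integrable f) (f0 : ∀ x, 0 ≤ f x) {l : ℝ} (hl : 0 < l) :
    ∫ x in Set.Ioo (-l) l, f x ≤ 4 * ∫ x, psi (x / l) * f x := by
  have pc := psi_continuous
  have i1 : Integrable fun x => psi (x / l) * f x :=
    integrable_bdd_mul (C := 2) hf (by fun_prop) fun x => weight_psi.b0 _
  rw [← integral_const_mul]
  calc ∫ x in Set.Ioo (-l) l, f x ≤ ∫ x in Set.Ioo (-l) l, 4 * (psi (x / l) * f x) := by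
        refine setIntegral_mono_on hf.integrableOn (i1.const_mul 4).integrableOn
          measurableSet_Ioo fun x hx => ?_
        have : |x / l| ≤ 1 := by
          rw [abs_div, abs_of_pos hl, div_le_one hl]
          exact (abs_lt.2 hx).le
        have := mul_le_mul_of_nonneg_right (quarter_le_psi this) (f0 x)
        linarith
    _ ≤ _ := setIntegral_le_integral (i1.const_mul 4) (ae_of_all _ fun x =>
        mul_nonneg (by norm_num) (mul_nonneg (psi_pos _).le (f0 x)))

lemma mom_weighted_le {b : ℝ} (hb : b ∈ Set.Ioo (0 : ℝ) 3) {u : ℝ → ℝ → ℝ}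
    (hu : IsH2NonnegMomentumSolution b u) {s : ℝ} (hs : Real.exp 2 ≤ s) :
    ∫ x, psi (x / lam (1 / 2) s) * mom u s x ≤ 5 * wmass psi u s := by
  have hs1 := one_lt_of hs
  have hs0 : 0 ≤ s := by linarith
  have hl0 : 0 < lam (1 / 2) s := lam_pos hs1
  have hl2 := half_le_lam hs
  obtain ⟨ux, -, -⟩ := sol_facts hb hu hs0
  have u0 : ∀ x, 0 ≤ u s x := fun x => (abs_nonneg _).trans (ux x)
  obtain ⟨i0, -, i1, -, i2, -⟩ := hu.2.2.2.2.2.2.2.2.2.1 s hs0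
  have hv1 : ContDiff ℝ 2 (deriv (u s)) := by
    have : ContDiff ℝ (2 + 1) (u s) := by norm_num; exact hu.2.1 s
    exact (contDiff_succ_iff_deriv.1 this).2.2
  unfold wmass
  set l := lam (1 / 2) s with hl
  have pc := psi_continuous
  have pc' := psi'_continuous
  have k0 : Integrable fun x => psi (x / l) * u s x :=
    integrable_bdd_mul (C := 2) i0 (by fun_prop) fun x => weight_psi.b0 _
  have k1 : Integrable fun x => psi (x / l) * deriv (u s) x :=
    integrable_bdd_mul (C := 2) i1 (by fun_prop) fun x => weight_psi.b0 _
  have k2 : Integrable fun x => psi (x / l) * deriv (deriv (u s)) x :=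
    integrable_bdd_mul (C := 2) i2 (by fun_prop) fun x => weight_psi.b0 _
  have k3 : Integrable fun x => (l⁻¹ * psi' (x / l)) * deriv (u s) x := by
    have : Integrable fun x => psi' (x / l) * deriv (u s) x :=
      integrable_bdd_mul (C := 2) i1 (by fun_prop) fun x => weight_psi.b3 _
    simpa [mul_assoc] using this.const_mul l⁻¹
  have ibp := integral_mul_deriv_eq_deriv_mul_of_integrable
      (u := fun x => psi (x / l)) (u' := fun x => l⁻¹ * psi' (x / l))
      (v := deriv (u s)) (v' := deriv (deriv (u s)))
      (fun x _ => by
        have := (psi_hasDerivAt (x / l)).comp x ((hasDerivAt_id x).div_const l)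
        refine HasDerivAt.congr_deriv this ?_
        simp; ring)
      (fun x _ => (hv1.differentiable (by norm_num) x).hasDerivAt) k2 k3 k1
  have e : ∫ x, psi (x / l) * mom u s x
      = (∫ x, psi (x / l) * u s x) - ∫ x, psi (x / l) * deriv (deriv (u s)) x := by
    rw [← integral_sub k0 k2]
    refine integral_congr_ae (ae_of_all _ fun x => ?_)
    simp only [mom]; ring
  rw [e, ibp, sub_neg_eq_add]
  have : ∫ x, (l⁻¹ * psi' (x / l)) * deriv (u s) x ≤ 4 * ∫ x, psi (x / l) * u s x := by
    rw [← integral_const_mul]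
    refine integral_mono k3 (k0.const_mul 4) fun x => ?_
    have hli : l⁻¹ ≤ 2 := by
      rw [inv_le_comm₀ hl0 two_pos]; linarith
    have hli0 : 0 < l⁻¹ := inv_pos.2 hl0
    calc (l⁻¹ * psi' (x / l)) * deriv (u s) x
        ≤ |(l⁻¹ * psi' (x / l)) * deriv (u s) x| := le_abs_self _
      _ = (l⁻¹ * |psi' (x / l)|) * |deriv (u s) x| := by
          rw [abs_mul, abs_mul, abs_of_pos hli0]
      _ ≤ (2 * (2 * psi (x / l))) * u s x := by
          have := psi_pos (x / l)
          refine mul_le_mul (mul_le_mul hli (psi'_abs_le _) (abs_nonneg _) (by norm_num)) (ux x)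
            (abs_nonneg _) (by positivity)
      _ = 4 * (psi (x / l) * u s x) := by ring
  linarith


/-- For a global classical `H²` solution with nonnegative momentum,
there is `L ∈ ℝ` with `lim_{t→∞} ∫_{Λ_{1/2}(t)} m(t,x) dx = L` and
`lim_{t→∞} ∫_{Λ_{1/2}(t)} u(t,x) dx = L`, where `Λ_{1/2}(t) = (-√t/log t, √t/log t)`;
by nonnegativity of `m(t,·)` and `u(t,·) = G m(t,·)` these are the `L¹` norms of `m(t)`
and `u(t)` on `Λ_{1/2}(t)`. -/
theorem L1_local_limits (b : ℝ) (hb : b ∈ Set.Ioo (0 : ℝ) 3)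
    (u : ℝ → ℝ → ℝ) (hu : IsH2NonnegMomentumSolution b u) :
    ∃ L : ℝ,
      Filter.Tendsto
        (fun t : ℝ => ∫ x in Set.Ioo (-(lam (1 / 2) t)) (lam (1 / 2) t), mom u t x)
        Filter.atTop (nhds L) ∧
      Filter.Tendsto
        (fun t : ℝ => ∫ x in Set.Ioo (-(lam (1 / 2) t)) (lam (1 / 2) t), u t x)
        Filter.atTop (nhds L) := by
  have hT := wmass_psi_tendsto hb hu
  have hge := eventually_ge_atTop (Real.exp 2)
  refine ⟨0, ?_, ?_⟩
  · have h20 : Tendsto (fun t => 20 * wmass psi u t) atTop (nhds 0) := by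
      simpa using hT.const_mul 20
    refine tendsto_of_tendsto_of_tendsto_of_le_of_le' tendsto_const_nhds h20 ?_ ?_
    · filter_upwards [hge] with t ht
      have h0 : 0 ≤ t := by linarith [one_lt_of ht]
      exact integral_nonneg fun x => hu.2.2.2.2.2.2.2.2.2.2.1 t x h0
    · filter_upwards [hge] with t ht
      have h0 : 0 ≤ t := by linarith [one_lt_of ht]
      obtain ⟨i0, -, -, -, i2, -⟩ := hu.2.2.2.2.2.2.2.2.2.1 t h0
      have := local_le (f := mom u t) (i0.sub i2) (fun x => hu.2.2.2.2.2.2.2.2.2.2.1 t x h0)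
        (lam_pos (one_lt_of ht))
      have := mom_weighted_le hb hu ht
      linarith
  · have h4 : Tendsto (fun t => 4 * wmass psi u t) atTop (nhds 0) := by
      simpa using hT.const_mul 4
    have u0 : ∀ t, Real.exp 2 ≤ t → ∀ x, 0 ≤ u t x := fun t ht x =>
      (abs_nonneg _).trans ((sol_facts hb hu (by linarith [one_lt_of ht])).1 x)
    refine tendsto_of_tendsto_of_tendsto_of_le_of_le' tendsto_const_nhds h4 ?_ ?_
    · filter_upwards [hge] with t ht
      exact integral_nonneg fun x => u0 t ht x
    · filter_upwards [hge] with t ht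
      have h0 : 0 ≤ t := by linarith [one_lt_of ht]
      exact local_le (hu.2.2.2.2.2.2.2.2.2.1 t h0).1 (u0 t ht) (lam_pos (one_lt_of ht))
end

section
/- Fix b ∈ (0,3) and let u be a global classical H² solution with nonnegative momentum of the b-family equation. Let φ(x) = (tanh x + 1)/2. Then there exist σ > 0, L > 0, and C > 0 such that for all t > 0, d/dt [ ∫_ℝ φ((x − σt)/L) m(t,x) dx ] ≤ −(Cσ/L) ∫_ℝ sech²((x − σt)/L) ( u(t,x)² + (∂_x u)(t,x)² ) dx. -/
open MeasureTheory Real Filter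

/-- The shifted weight `φ(x) = (tanh x + 1)/2`. -/
noncomputable def phiW (x : ℝ) : ℝ := (Real.tanh x + 1) / 2

noncomputable def W0 (y : ℝ) : ℝ := phiW (y / 4)
noncomputable def W1 (y : ℝ) : ℝ := sech2 (y / 4) / 8
noncomputable def W2 (y : ℝ) : ℝ := -(Real.tanh (y / 4) * sech2 (y / 4)) / 16
noncomputable def W3 (y : ℝ) : ℝ := sech2 (y / 4) * (2 - 3 * sech2 (y / 4)) / 64

lemma sech2_pos (z : ℝ) : 0 < sech2 z := by
  unfold sech2
  have := Real.cosh_pos z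
  positivity

lemma sech2_eq (z : ℝ) : sech2 z = 1 / (1 + Real.sinh z ^ 2) := by
  unfold sech2
  rw [div_pow, one_pow, Real.cosh_sq, add_comm]

lemma sech2_le_one (z : ℝ) : sech2 z ≤ 1 := by
  rw [sech2_eq, div_le_one (by positivity)]
  nlinarith [sq_nonneg (Real.sinh z)]

lemma abs_le_abs_sinh (z : ℝ) : |z| ≤ |Real.sinh z| := by
  rw [Real.abs_sinh]
  exact Real.self_le_sinh_iff.2 (abs_nonneg z)

lemma sech2_le (z : ℝ) : sech2 z ≤ (1 + z ^ 2)⁻¹ := by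
  rw [sech2_eq, one_div]
  have := sq_le_sq.2 (abs_le_abs_sinh z)
  gcongr

lemma sech2_tanh (z : ℝ) : sech2 z = 1 - Real.tanh z ^ 2 := by
  unfold sech2
  have := Real.cosh_pos z
  rw [Real.tanh_eq_sinh_div_cosh]
  field_simp
  rw [Real.cosh_sq]; ring

lemma tanh_hasDeriv (z : ℝ) : HasDerivAt Real.tanh (sech2 z) z := by
  have h := (Real.hasDerivAt_sinh z).div (Real.hasDerivAt_cosh z) (Real.cosh_pos z).ne'
  have e : Real.tanh = Real.sinh / Real.cosh := by
    funext x; simp [Real.tanh_eq_sinh_div_cosh]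
  rw [e]
  refine h.congr_deriv ?_
  unfold sech2
  have := Real.cosh_pos z
  field_simp
  nlinarith [Real.cosh_sq z]

lemma tanh4_hasDeriv (y : ℝ) : HasDerivAt (fun y : ℝ => Real.tanh (y / 4)) (sech2 (y / 4) / 4) y := by
  have h := (tanh_hasDeriv (y / 4)).comp y ((hasDerivAt_id y).div_const 4)
  refine h.congr_deriv ?_
  ring

lemma W0_hasDeriv (y : ℝ) : HasDerivAt W0 (W1 y) y := by
  have h := ((tanh4_hasDeriv y).add_const 1).div_const 2
  refine h.congr_deriv ?_
  unfold W1; ring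

lemma sech4_hasDeriv (y : ℝ) : HasDerivAt (fun y : ℝ => sech2 (y / 4))
    (-(Real.tanh (y / 4) * sech2 (y / 4)) / 2) y := by
  have h := ((tanh4_hasDeriv y).pow 2).const_sub 1
  have e : (fun y : ℝ => sech2 (y / 4)) = fun y => 1 - Real.tanh (y / 4) ^ 2 := by
    funext x; rw [sech2_tanh]
  rw [e]
  refine h.congr_deriv ?_
  simp; ring

lemma W1_hasDeriv (y : ℝ) : HasDerivAt W1 (W2 y) y := by
  have h := (sech4_hasDeriv y).div_const 8
  refine h.congr_deriv ?_
  unfold W2; ring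

lemma W2_hasDeriv (y : ℝ) : HasDerivAt W2 (W3 y) y := by
  have h := (((tanh4_hasDeriv y).mul (sech4_hasDeriv y)).neg).div_const 16
  refine h.congr_deriv ?_
  unfold W3
  have := sech2_tanh (y / 4)
  have e : Real.tanh (y / 4) ^ 2 = 1 - sech2 (y / 4) := by linarith
  linear_combination ((sech2 (y / 4)) / 32) * e

lemma W0_cont : Continuous W0 := continuous_iff_continuousAt.2 fun y => (W0_hasDeriv y).continuousAt
lemma W1_cont : Continuous W1 := continuous_iff_continuousAt.2 fun y => (W1_hasDeriv y).continuousAt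
lemma W2_cont : Continuous W2 := continuous_iff_continuousAt.2 fun y => (W2_hasDeriv y).continuousAt
lemma sech4_cont : Continuous (fun y : ℝ => sech2 (y / 4)) :=
  continuous_iff_continuousAt.2 fun y => (sech4_hasDeriv y).continuousAt
lemma W3_cont : Continuous W3 := by
  have := sech4_cont
  unfold W3
  fun_prop

lemma tanh_abs_le (z : ℝ) : |Real.tanh z| ≤ 1 := by
  have := sech2_tanh z
  have := sech2_pos z
  exact abs_le_one_iff_mul_self_le_one.2 (by nlinarith)

lemma W1_pos (y : ℝ) : 0 < W1 y := by
  have := sech2_pos (y / 4)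
  unfold W1; positivity
lemma W1_le (y : ℝ) : W1 y ≤ 1 := by
  have := sech2_le_one (y / 4)
  unfold W1; linarith
lemma W0_abs (y : ℝ) : |W0 y| ≤ 1 := by
  have := abs_le.1 (tanh_abs_le (y / 4))
  unfold W0 phiW; rw [abs_le]; constructor <;> linarith
lemma W2_abs (y : ℝ) : |W2 y| ≤ W1 y := by
  have h := tanh_abs_le (y / 4)
  have h2 := sech2_pos (y / 4)
  unfold W2 W1
  rw [abs_div, abs_neg, abs_mul, abs_of_pos h2, abs_of_pos (by norm_num : (0:ℝ) < 16)]
  nlinarith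
lemma W3_abs (y : ℝ) : |W3 y| ≤ W1 y / 4 := by
  have h2 := sech2_pos (y / 4)
  have h1 := sech2_le_one (y / 4)
  unfold W3 W1
  rw [abs_le]; constructor <;> nlinarith

lemma W1_integrable : Integrable W1 := by
  have h : Integrable (fun y : ℝ => (1 + (y / 4) ^ 2)⁻¹) :=
    integrable_inv_one_add_sq.comp_div (by norm_num)
  refine h.mono' W1_cont.aestronglyMeasurable (ae_of_all _ fun y => ?_)
  rw [Real.norm_of_nonneg (W1_pos y).le]
  have := sech2_le (y / 4)
  have := sech2_pos (y / 4)
  unfold W1; linarith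

lemma exp_neg_abs_integrable : Integrable (fun z : ℝ => Real.exp (-|z|)) := by
  have h : Integrable (fun y : ℝ => 2 * (1 + y ^ 2)⁻¹) := integrable_inv_one_add_sq.const_mul 2
  refine h.mono' (by fun_prop) (ae_of_all _ fun y => ?_)
  rw [Real.norm_of_nonneg (Real.exp_pos _).le, Real.exp_neg]
  have := Real.quadratic_le_exp_of_nonneg (abs_nonneg y)
  rw [sq_abs] at this
  have h3 : (1 + y ^ 2) / 2 ≤ Real.exp |y| := by nlinarith [abs_nonneg y]
  calc (Real.exp |y|)⁻¹ ≤ ((1 + y ^ 2) / 2)⁻¹ := by gcongr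
    _ = 2 * (1 + y ^ 2)⁻¹ := by rw [inv_div]; rfl

/-- Static bounds. -/
lemma static_bounds (v v1 v2 : ℝ → ℝ) (h1 : ∀ x, HasDerivAt v (v1 x) x)
    (h2 : ∀ x, HasDerivAt v1 (v2 x) x) (i0 : Integrable v) (i1 : Integrable v1)
    (i2 : Integrable v2) (hm : ∀ x, 0 ≤ v x - v2 x) :
    (∀ x, |v1 x| ≤ v x) ∧ (∀ x, v x ≤ ∫ x, (v x - v2 x)) ∧ (∫ x, v x = ∫ x, (v x - v2 x)) ∧
    Tendsto v atTop (nhds 0) ∧ Tendsto v atBot (nhds 0) := by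
  have t0 := tendsto_zero_of_hasDerivAt_of_integrableOn_Ioi (a := 0) (fun x _ => h1 x)
    i1.integrableOn i0.integrableOn
  have t0' := tendsto_zero_of_hasDerivAt_of_integrableOn_Iic (a := 0) (fun x _ => h1 x)
    i1.integrableOn i0.integrableOn
  have t1 := tendsto_zero_of_hasDerivAt_of_integrableOn_Ioi (a := 0) (fun x _ => h2 x)
    i2.integrableOn i1.integrableOn
  have t1' := tendsto_zero_of_hasDerivAt_of_integrableOn_Iic (a := 0) (fun x _ => h2 x)
    i2.integrableOn i1.integrableOn
  have A : ∀ x, 0 ≤ v x - v1 x := by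
    have hd : ∀ x, HasDerivAt (fun x => Real.exp x * (v x - v1 x))
        (Real.exp x * (v x - v2 x)) x := by
      intro x
      refine HasDerivAt.congr_deriv ((Real.hasDerivAt_exp x).mul ((h1 x).sub (h2 x))) ?_
      ring
    have mono : Monotone (fun x => Real.exp x * (v x - v1 x)) :=
      monotone_of_hasDerivAt_nonneg hd (fun x => mul_nonneg (Real.exp_pos x).le (hm x))
    have lim : Tendsto (fun x => Real.exp x * (v x - v1 x)) atBot (nhds 0) := by
      simpa using Real.tendsto_exp_atBot.mul (t0'.sub t1')
    intro x
    have := mono.le_of_tendsto lim x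
    exact nonneg_of_mul_nonneg_right this (Real.exp_pos x)
  have B : ∀ x, 0 ≤ v x + v1 x := by
    have hd : ∀ x, HasDerivAt (fun x => Real.exp (-x) * (v x + v1 x))
        (-(Real.exp (-x) * (v x - v2 x))) x := by
      intro x
      refine HasDerivAt.congr_deriv (((Real.hasDerivAt_exp (-x)).comp x (hasDerivAt_neg x)).mul ((h1 x).add (h2 x))) ?_
      simp; ring
    have mono : Antitone (fun x => Real.exp (-x) * (v x + v1 x)) :=
      antitone_of_hasDerivAt_nonpos hd
        (fun x => neg_nonpos.2 (mul_nonneg (Real.exp_pos _).le (hm x)))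
    have lim : Tendsto (fun x => Real.exp (-x) * (v x + v1 x)) atTop (nhds 0) := by
      simpa using (Real.tendsto_exp_atBot.comp tendsto_neg_atTop_atBot).mul (t0.add t1)
    intro x
    have := mono.le_of_tendsto lim x
    exact nonneg_of_mul_nonneg_right this (Real.exp_pos _)
  have C : ∀ x, |v1 x| ≤ v x := fun x => abs_le.2 ⟨by linarith [B x], by linarith [A x]⟩
  have D : ∫ x, v x = ∫ x, (v x - v2 x) := by
    rw [integral_sub i0 i2, integral_eq_zero_of_hasDerivAt_of_integrable h2 i2 i1, sub_zero]
  refine ⟨C, fun x => ?_, D, t0, t0'⟩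
  rw [← D]
  have := integral_Iic_of_hasDerivAt_of_tendsto' (a := x) (fun y _ => h1 y) i1.integrableOn t0'
  rw [sub_zero] at this
  rw [← this]
  calc ∫ y in Set.Iic x, v1 y ≤ ∫ y in Set.Iic x, v y :=
        setIntegral_mono i1.integrableOn i0.integrableOn fun y => (le_abs_self _).trans (C y)
    _ ≤ ∫ y, v y := setIntegral_le_integral i0 (ae_of_all _ fun y => (abs_nonneg _).trans (C y))

lemma G_integrand_integrable (f : ℝ → ℝ) (hi : Integrable f) (x : ℝ) :
    Integrable (fun y => Real.exp (-|x - y|) * f y) := by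
  refine hi.bdd_mul (c := 1) (by fun_prop) (ae_of_all _ fun y => ?_)
  rw [Real.norm_of_nonneg (Real.exp_pos _).le]
  exact Real.exp_le_one_iff.2 (neg_nonpos.2 (abs_nonneg _))

lemma G_static (f : ℝ → ℝ) (hf : Continuous f) (hi : Integrable f) (h0 : ∀ x, 0 ≤ f x) :
    ∃ K1 : ℝ → ℝ, (∀ x, HasDerivAt (G f) (K1 x) x) ∧
      (∀ x, HasDerivAt K1 (G f x - f x) x) ∧ (∀ x, |K1 x| ≤ G f x) ∧
      (∀ x, 0 ≤ G f x) ∧ (∀ x, G f x ≤ 1 / 2 * ∫ y, f y) ∧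
      Tendsto (G f) atTop (nhds 0) ∧ Tendsto (G f) atBot (nhds 0) := by
  have iA : ∀ x, IntegrableOn (fun y => Real.exp y * f y) (Set.Iic x) := by
    intro x
    refine hi.integrableOn.bdd_mul (c := Real.exp x) (by fun_prop) ?_
    refine (ae_restrict_iff' measurableSet_Iic).2 (ae_of_all _ fun y hy => ?_)
    rw [Real.norm_of_nonneg (Real.exp_pos _).le]
    exact Real.exp_le_exp.2 hy
  have iB : ∀ x, IntegrableOn (fun y => Real.exp (-y) * f y) (Set.Ioi x) := by
    intro x
    refine hi.integrableOn.bdd_mul (c := Real.exp (-x)) (by fun_prop) ?_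
    refine (ae_restrict_iff' measurableSet_Ioi).2 (ae_of_all _ fun y hy => ?_)
    rw [Real.norm_of_nonneg (Real.exp_pos _).le]
    exact Real.exp_le_exp.2 (neg_le_neg (le_of_lt hy))
  set A : ℝ → ℝ := fun x => ∫ y in Set.Iic x, Real.exp y * f y with hA
  set B : ℝ → ℝ := fun x => ∫ y in Set.Ioi x, Real.exp (-y) * f y with hB
  have cA : Continuous (fun y => Real.exp y * f y) := by fun_prop
  have cB : Continuous (fun y => Real.exp (-y) * f y) := by fun_prop
  have dA : ∀ x, HasDerivAt A (Real.exp x * f x) x := by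
    intro x
    have e : A = fun x => A 0 + ∫ y in (0:ℝ)..x, Real.exp y * f y := by
      funext x
      have := intervalIntegral.integral_Iic_sub_Iic (iA 0) (iA x)
      simp only [hA]
      rw [← this]; ring
    rw [e]
    exact (intervalIntegral.integral_hasDerivAt_right (cA.intervalIntegrable _ _)
      cA.aestronglyMeasurable.stronglyMeasurableAtFilter cA.continuousAt).const_add _
  have dB : ∀ x, HasDerivAt B (-(Real.exp (-x) * f x)) x := by
    intro x
    have e : B = fun x => B 0 - ∫ y in (0:ℝ)..x, Real.exp (-y) * f y := by
      funext x
      have := intervalIntegral.integral_Ioi_sub_Ioi' (iB 0) (iB x)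
      simp only [hB]
      rw [← this]; ring
    rw [e]
    exact (intervalIntegral.integral_hasDerivAt_right (cB.intervalIntegrable _ _)
      cB.aestronglyMeasurable.stronglyMeasurableAtFilter cB.continuousAt).const_sub _
  have hG : G f = fun x => (Real.exp (-x) * A x + Real.exp x * B x) / 2 := by
    funext x
    unfold G
    rw [← intervalIntegral.integral_Iic_add_Ioi (b := x) (G_integrand_integrable f hi x).integrableOn
      (G_integrand_integrable f hi x).integrableOn]
    have e1 : ∫ y in Set.Iic x, Real.exp (-|x - y|) * f y = Real.exp (-x) * A x := by
      simp only [hA]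
      rw [← integral_const_mul]
      refine setIntegral_congr_fun measurableSet_Iic fun y hy => ?_
      have : (0:ℝ) ≤ x - y := sub_nonneg.2 hy
      rw [abs_of_nonneg this, ← mul_assoc, ← Real.exp_add]
      ring_nf
    have e2 : ∫ y in Set.Ioi x, Real.exp (-|x - y|) * f y = Real.exp x * B x := by
      simp only [hB]
      rw [← integral_const_mul]
      refine setIntegral_congr_fun measurableSet_Ioi fun y hy => ?_
      have : x - y ≤ 0 := sub_nonpos.2 (le_of_lt hy)
      rw [abs_of_nonpos this, ← mul_assoc, ← Real.exp_add]
      ring_nf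
    rw [e1, e2]; ring
  have dn : ∀ x : ℝ, HasDerivAt (fun x : ℝ => Real.exp (-x)) (-Real.exp (-x)) x := by
    intro x
    refine HasDerivAt.congr_deriv ((Real.hasDerivAt_exp (-x)).comp x (hasDerivAt_neg x)) ?_
    ring
  have ee : ∀ x : ℝ, Real.exp (-x) * Real.exp x = 1 := by
    intro x; rw [← Real.exp_add]; simp
  have A0 : ∀ x, 0 ≤ Real.exp (-x) * A x := fun x => mul_nonneg (Real.exp_pos _).le
    (setIntegral_nonneg measurableSet_Iic fun y _ => mul_nonneg (Real.exp_pos _).le (h0 y))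
  have B0 : ∀ x, 0 ≤ Real.exp x * B x := fun x => mul_nonneg (Real.exp_pos _).le
    (setIntegral_nonneg measurableSet_Ioi fun y _ => mul_nonneg (Real.exp_pos _).le (h0 y))
  have ble : ∀ x y, Real.exp (-|x - y|) * f y ≤ f y := by
    intro x y
    have : Real.exp (-|x - y|) ≤ 1 := Real.exp_le_one_iff.2 (neg_nonpos.2 (abs_nonneg _))
    nlinarith [h0 y]
  have lim : ∀ l : Filter ℝ, l.IsCountablyGenerated →
      (∀ y : ℝ, Tendsto (fun x : ℝ => |x - y|) l atTop) → Tendsto (G f) l (nhds 0) := by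
    intro l hl hy
    have : Tendsto (fun x => ∫ y, Real.exp (-|x - y|) * f y) l (nhds (∫ y : ℝ, (0:ℝ))) := by
      refine tendsto_integral_filter_of_dominated_convergence f
        (Eventually.of_forall fun x => (G_integrand_integrable f hi x).aestronglyMeasurable)
        (Eventually.of_forall fun x => ae_of_all _ fun y => ?_) hi (ae_of_all _ fun y => ?_)
      · rw [Real.norm_of_nonneg (mul_nonneg (Real.exp_pos _).le (h0 y))]
        exact ble x y
      · have := (Real.tendsto_exp_neg_atTop_nhds_zero.comp (hy y)).mul_const (f y)
        simpa using this
    have := this.const_mul (1 / 2)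
    rw [integral_zero, mul_zero] at this
    exact this
  refine ⟨fun x => (Real.exp x * B x - Real.exp (-x) * A x) / 2, ?_, ?_, ?_, ?_, ?_, ?_, ?_⟩
  · intro x
    rw [hG]
    refine HasDerivAt.congr_deriv ((((dn x).mul (dA x)).add
      ((Real.hasDerivAt_exp x).mul (dB x))).div_const 2) ?_
    ring
  · intro x
    rw [hG]
    refine HasDerivAt.congr_deriv ((((Real.hasDerivAt_exp x).mul (dB x)).sub
      ((dn x).mul (dA x))).div_const 2) ?_
    linear_combination (-f x) * ee x
  · intro x
    rw [hG, abs_le]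
    constructor <;> simp only <;> linarith [A0 x, B0 x]
  · intro x
    rw [hG]
    simp only
    linarith [A0 x, B0 x]
  · intro x
    unfold G
    exact mul_le_mul_of_nonneg_left
      (integral_mono (G_integrand_integrable f hi x) hi (ble x)) (by norm_num)
  · refine lim _ inferInstance fun y => ?_
    exact tendsto_abs_atTop_atTop.comp (tendsto_atTop_add_const_right _ (-y) tendsto_id)
  · refine lim _ inferInstance fun y => ?_
    exact tendsto_abs_atBot_atTop.comp (tendsto_atBot_add_const_right _ (-y) tendsto_id)

/-- Joint continuity of `G f`. -/
lemma G_cont (f : ℝ → ℝ → ℝ) (hf : Continuous (fun p : ℝ × ℝ => f p.1 p.2)) (C : ℝ)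
    (hC : ∀ s, 0 ≤ s → ∀ x, |f s x| ≤ C) (t : ℝ) (ht : 0 < t) (x : ℝ) :
    ContinuousAt (fun p : ℝ × ℝ => G (f p.1) p.2) (t, x) := by
  have e : (fun p : ℝ × ℝ => G (f p.1) p.2) =
      fun p : ℝ × ℝ => (1 / 2) * ∫ z, Real.exp (-|z|) * f p.1 (p.2 - z) := by
    funext p
    unfold G
    congr 1
    rw [← integral_sub_left_eq_self _ volume p.2]
    simp
  rw [e]
  refine ContinuousAt.mul continuousAt_const ?_
  refine continuousAt_of_dominated (bound := fun z => Real.exp (-|z|) * C) ?_ ?_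
    (exp_neg_abs_integrable.mul_const C) (ae_of_all _ fun z => ?_)
  · refine Eventually.of_forall fun p => Continuous.aestronglyMeasurable ?_
    exact (by fun_prop : Continuous fun z : ℝ => Real.exp (-|z|)).mul
      (hf.comp (by fun_prop : Continuous fun z : ℝ => (p.1, p.2 - z)))
  · have : ∀ᶠ p : ℝ × ℝ in nhds (t, x), 0 < p.1 :=
      continuous_fst.continuousAt.eventually (lt_mem_nhds ht)
    filter_upwards [this] with p hp
    refine ae_of_all _ fun z => ?_
    rw [norm_mul, Real.norm_of_nonneg (Real.exp_pos _).le]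
    exact mul_le_mul_of_nonneg_left (hC _ hp.le _) (Real.exp_pos _).le
  · exact (continuous_const.mul
      (hf.comp (by fun_prop : Continuous fun p : ℝ × ℝ => (p.1, p.2 - z)))).continuousAt

lemma dyn (u ut J : ℝ → ℝ → ℝ) (ψ ψ' : ℝ → ℝ) (C D σ : ℝ)
    (cu : Continuous (fun p : ℝ × ℝ => u p.1 p.2))
    (cut : Continuous (fun p : ℝ × ℝ => ut p.1 p.2))
    (hut : ∀ s x, 0 < s → HasDerivAt (fun s => u s x) (ut s x) s)
    (hJ : ∀ s x, 0 < s → HasDerivAt (J s) (-ut s x) x)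
    (cJ : ∀ s x, 0 < s → ContinuousAt (fun p : ℝ × ℝ => J p.1 p.2) (s, x))
    (bJ : ∀ s x, 0 < s → |J s x| ≤ C) (bu : ∀ s x, 0 < s → |u s x| ≤ C)
    (tJ : ∀ s, 0 < s → Tendsto (J s) atTop (nhds 0))
    (tJ' : ∀ s, 0 < s → Tendsto (J s) atBot (nhds 0))
    (iu : ∀ s, 0 < s → Integrable (u s))
    (hψ : ∀ x, HasDerivAt ψ (ψ' x) x) (bψ : ∀ x, |ψ x| ≤ D) (cψ' : Continuous ψ')
    (iψ' : Integrable ψ') (t : ℝ) (ht : 0 < t) :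
    HasDerivAt (fun s => ∫ x, ψ (x - σ * s) * u s x)
      (∫ x, ψ' (x - σ * t) * (J t x - σ * u t x)) t := by
  have cψ : Continuous ψ := continuous_iff_continuousAt.2 fun y => (hψ y).continuousAt
  have C0 : 0 ≤ C := (abs_nonneg _).trans (bu t 0 ht)
  have D0 : 0 ≤ D := (abs_nonneg _).trans (bψ 0)
  have cus : ∀ s, Continuous (u s) := fun s =>
    cu.comp (by fun_prop : Continuous fun x : ℝ => (s, x))
  have cuts : ∀ s, Continuous (ut s) := fun s =>
    cut.comp (by fun_prop : Continuous fun x : ℝ => (s, x))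
  have cJs : ∀ s, 0 < s → Continuous (J s) := fun s hs =>
    continuous_iff_continuousAt.2 fun y => (hJ s y hs).continuousAt
  have bw : ∀ s x, 0 < s → |J s x - σ * u s x| ≤ C + |σ| * C := by
    intro s x hs
    refine (abs_sub _ _).trans ?_
    rw [abs_mul]
    have := bJ s x hs
    have := bu s x hs
    gcongr
  set H : ℝ → ℝ := fun s => ∫ x, ψ' (x - σ * s) * (J s x - σ * u s x) with hH
  set E : ℝ := C + |σ| * C with hE
  have E0 : 0 ≤ E := (abs_nonneg _).trans (bw t 0 ht)
  -- continuity of H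
  have cH : ∀ s, 0 < s → ContinuousAt H s := by
    intro s hs
    have e : H = fun s => ∫ x, ψ' x * (J s (x + σ * s) - σ * u s (x + σ * s)) := by
      funext r
      simp only [hH]
      rw [← integral_add_right_eq_self _ (σ * r)]
      simp
    rw [e]
    have ev : ∀ᶠ r in nhds s, 0 < r := lt_mem_nhds hs
    refine continuousAt_of_dominated (bound := fun x => ‖ψ' x‖ * E) ?_ ?_
      (iψ'.norm.mul_const E) (ae_of_all _ fun x => ?_)
    · filter_upwards [ev] with r hr
      refine Continuous.aestronglyMeasurable ?_
      have := cJs r hr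
      have := cus r
      fun_prop
    · filter_upwards [ev] with r hr
      refine ae_of_all _ fun x => ?_
      rw [norm_mul]
      exact mul_le_mul_of_nonneg_left (bw _ _ hr) (norm_nonneg _)
    · have c1 : ContinuousAt (fun r : ℝ => (r, x + σ * r)) s := by fun_prop
      have c2 : ContinuousAt (fun r : ℝ => J r (x + σ * r)) s :=
        ContinuousAt.comp (f := fun r : ℝ => (r, x + σ * r))
          (g := fun p : ℝ × ℝ => J p.1 p.2) (cJ s (x + σ * s) hs) c1
      have c3 : ContinuousAt (fun r : ℝ => u r (x + σ * r)) s :=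
        ContinuousAt.comp (f := fun r : ℝ => (r, x + σ * r))
          (g := fun p : ℝ × ℝ => u p.1 p.2) cu.continuousAt c1
      fun_prop
  -- integrability of the integrand of H
  have iH : ∀ s, 0 < s → Integrable (fun x => ψ' (x - σ * s) * (J s x - σ * u s x)) := by
    intro s hs
    have := cJs s hs
    have := cus s
    refine (iψ'.comp_sub_right (σ * s)).mul_bdd (c := E) (by fun_prop) (ae_of_all _ fun x => bw s x hs)
  set FR : ℝ → ℝ → ℝ := fun R s => ∫ x in (-R)..R, ψ (x - σ * s) * u s x with hFR
  set g : ℝ → ℝ → ℝ := fun s x => -σ * ψ' (x - σ * s) * u s x + ψ (x - σ * s) * ut s x with hg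
  have cg : Continuous (fun p : ℝ × ℝ => g p.1 p.2) := by
    simp only [hg]; fun_prop
  have cgs : ∀ s, Continuous (g s) := fun s =>
    cg.comp (by fun_prop : Continuous fun x : ℝ => (s, x))
  set DR : ℝ → ℝ → ℝ := fun R s => ∫ x in (-R)..R, g s x with hDR
  have cDR : ∀ R, Continuous (DR R) := fun R =>
    intervalIntegral.continuous_parametric_intervalIntegral_of_continuous' cg _ _
  have dFR : ∀ R s, 0 < s → HasDerivAt (FR R) (DR R s) s := by
    intro R s hs
    obtain ⟨B, hB⟩ := ((isCompact_Icc (a := s / 2) (b := 2 * s)).prod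
      (isCompact_uIcc (a := -R) (b := R))).exists_bound_of_continuousOn cg.continuousOn
    refine (intervalIntegral.hasDerivAt_integral_of_dominated_loc_of_deriv_le (F' := g)
      (bound := fun _ => B) (Icc_mem_nhds (a := s / 2) (b := 2 * s) (by linarith) (by linarith))
      ?_ ?_ ?_ ?_ ?_ ?_).2
    · refine Eventually.of_forall fun r => Continuous.aestronglyMeasurable ?_
      have := cus r
      fun_prop
    · have := cus s
      exact Continuous.intervalIntegrable (by fun_prop) _ _
    · exact (cgs s).aestronglyMeasurable
    · exact ae_of_all _ fun x hx r hr => hB (r, x) ⟨hr, Set.uIoc_subset_uIcc hx⟩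
    · exact intervalIntegrable_const
    · refine ae_of_all _ fun x hx r hr => ?_
      have hr0 : 0 < r := by linarith [hr.1]
      have h1 : HasDerivAt (fun r : ℝ => x - σ * r) (-σ) r := by
        refine (((hasDerivAt_id r).const_mul σ).const_sub x).congr_deriv (by simp)
      have h2 := (hψ (x - σ * r)).comp r h1
      refine (h2.mul (hut r x hr0)).congr_deriv ?_
      simp only [hg, Function.comp]; ring
  have eDR : ∀ R s, 0 < s → DR R s = (∫ x in (-R)..R, ψ' (x - σ * s) * (J s x - σ * u s x))
      - (ψ (R - σ * s) * J s R - ψ (-R - σ * s) * J s (-R)) := by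
    intro R s hs
    have := cJs s hs
    have := cus s
    have := cuts s
    have hd : ∀ x ∈ Set.uIcc (-R) R, HasDerivAt (fun x => ψ (x - σ * s) * J s x)
        (ψ' (x - σ * s) * J s x - ψ (x - σ * s) * ut s x) x := by
      intro x _
      have h2 := (hψ (x - σ * s)).comp_sub_const x (σ * s)
      refine (h2.mul (hJ s x hs)).congr_deriv ?_
      ring
    rw [← intervalIntegral.integral_eq_sub_of_hasDerivAt hd
      (Continuous.intervalIntegrable (by fun_prop) _ _), ← intervalIntegral.integral_sub
      (Continuous.intervalIntegrable (by fun_prop) _ _)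
      (Continuous.intervalIntegrable (by fun_prop) _ _)]
    simp only [hDR, hg]
    congr 1
    funext x
    ring
  have bDR : ∀ R s, 0 ≤ R → 0 < s → |DR R s| ≤ (∫ x, |ψ' x|) * E + 2 * (D * C) := by
    intro R s hR hs
    rw [eDR R s hs]
    have h1 : |∫ x in (-R)..R, ψ' (x - σ * s) * (J s x - σ * u s x)| ≤ (∫ x, |ψ' x|) * E := by
      rw [intervalIntegral.integral_of_le (by linarith), ← Real.norm_eq_abs]
      refine (norm_integral_le_integral_norm _).trans ?_
      refine (setIntegral_le_integral (iH s hs).norm (ae_of_all _ fun x => norm_nonneg _)).trans ?_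
      have e : (∫ x, |ψ' x|) * E = ∫ x, |ψ' (x - σ * s)| * E := by
        rw [integral_mul_const, integral_sub_right_eq_self (fun x => |ψ' x|) (σ * s)]
      rw [e]
      refine integral_mono (iH s hs).norm ((iψ'.comp_sub_right (σ * s)).norm.mul_const E) fun x => ?_
      simp only [norm_mul, Real.norm_eq_abs]
      exact mul_le_mul_of_nonneg_left (bw s x hs) (abs_nonneg _)
    have h2 : ∀ y z, |ψ y * J s z| ≤ D * C := by
      intro y z
      rw [abs_mul]
      exact mul_le_mul (bψ y) (bJ s z hs) (abs_nonneg _) D0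
    have h3 := abs_sub (ψ (R - σ * s) * J s R) (ψ (-R - σ * s) * J s (-R))
    have h4 := abs_sub (∫ x in (-R)..R, ψ' (x - σ * s) * (J s x - σ * u s x))
      (ψ (R - σ * s) * J s R - ψ (-R - σ * s) * J s (-R))
    linarith [h2 (R - σ * s) R, h2 (-R - σ * s) (-R)]
  have tn : Tendsto (fun n : ℕ => (n : ℝ)) atTop atTop := tendsto_natCast_atTop_atTop
  have tn' : Tendsto (fun n : ℕ => -(n : ℝ)) atTop atBot := tendsto_neg_atTop_atBot.comp tn
  have lDR : ∀ s, 0 < s → Tendsto (fun n : ℕ => DR n s) atTop (nhds (H s)) := by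
    intro s hs
    have h1 := intervalIntegral_tendsto_integral (iH s hs) tn' tn
    have hz : ∀ (y : ℕ → ℝ) (z : ℕ → ℝ), Tendsto (fun n => J s (z n)) atTop (nhds 0) →
        Tendsto (fun n => ψ (y n) * J s (z n)) atTop (nhds 0) := by
      intro y z hz
      refine squeeze_zero_norm (a := fun n => D * |J s (z n)|) (fun n => ?_) ?_
      · rw [norm_mul]
        exact mul_le_mul_of_nonneg_right (bψ _) (abs_nonneg _)
      · simpa using hz.abs.const_mul D
    have h2 := hz (fun n => (n : ℝ) - σ * s) (fun n => (n : ℝ)) ((tJ s hs).comp tn)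
    have h3 := hz (fun n => -(n : ℝ) - σ * s) (fun n => -(n : ℝ)) ((tJ' s hs).comp tn')
    have h4 := h1.sub (h2.sub h3)
    simp only [sub_zero] at h4
    refine h4.congr fun n => ?_
    rw [eDR _ s hs]
  have lFR : ∀ s, 0 < s → Tendsto (fun n : ℕ => FR n s) atTop
      (nhds (∫ x, ψ (x - σ * s) * u s x)) := by
    intro s hs
    refine intervalIntegral_tendsto_integral ?_ tn' tn
    exact (iu s hs).bdd_mul (c := D) (by fun_prop) (ae_of_all _ fun x => bψ _)
  have key : ∀ s, 0 < s → (∫ x, ψ (x - σ * s) * u s x) =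
      (∫ x, ψ (x - σ * t) * u t x) + ∫ r in t..s, H r := by
    intro s hs
    have hpos : ∀ r ∈ Set.uIcc t s, 0 < r := fun r hr => (lt_min ht hs).trans_le hr.1
    have h1 : ∀ n : ℕ, ∫ r in t..s, DR n r = FR n s - FR n t := fun n =>
      intervalIntegral.integral_eq_sub_of_hasDerivAt (fun r hr => dFR n r (hpos r hr))
        ((cDR n).intervalIntegrable _ _)
    have h2 : Tendsto (fun n : ℕ => ∫ r in t..s, DR n r) atTop (nhds (∫ r in t..s, H r)) := by
      refine intervalIntegral.tendsto_integral_filter_of_dominated_convergence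
        (fun _ => (∫ x, |ψ' x|) * E + 2 * (D * C)) (Eventually.of_forall fun n =>
          (cDR n).aestronglyMeasurable) (Eventually.of_forall fun n => ae_of_all _ fun r hr => ?_)
        intervalIntegrable_const (ae_of_all _ fun r hr => ?_)
      · exact bDR n r n.cast_nonneg (hpos r (Set.uIoc_subset_uIcc hr))
      · exact lDR r (hpos r (Set.uIoc_subset_uIcc hr))
    have h3 := (lFR s hs).sub (lFR t ht)
    have h4 := tendsto_nhds_unique (h2.congr h1) h3
    linarith
  have hder : HasDerivAt (fun s => (∫ x, ψ (x - σ * t) * u t x) + ∫ r in t..s, H r) (H t) t := by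
    have cOn : ContinuousOn H (Set.Ioi 0) := fun s hs => (cH s hs).continuousWithinAt
    exact (intervalIntegral.integral_hasDerivAt_right (by simp)
      (cOn.stronglyMeasurableAtFilter isOpen_Ioi t ht) (cH t ht)).const_add _
  refine hder.congr_of_eventuallyEq ?_
  filter_upwards [lt_mem_nhds ht] with s hs
  exact key s hs

theorem traveling_functional_monotonicity (b : ℝ) (hb : b ∈ Set.Ioo (0 : ℝ) 3)
    (u : ℝ → ℝ → ℝ) (hu : IsH2NonnegMomentumSolution b u) :
    ∃ σ : ℝ, 0 < σ ∧ ∃ L : ℝ, 0 < L ∧ ∃ C : ℝ, 0 < C ∧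
      ∀ t : ℝ, 0 < t →
        deriv (fun s : ℝ => ∫ x : ℝ, phiW ((x - σ * s) / L) * mom u s x) t
          ≤ -(C * σ / L) *
            ∫ x : ℝ, sech2 ((x - σ * t) / L) * ((u t x) ^ 2 + (deriv (u t) x) ^ 2) := by
  obtain ⟨ut1, ux3, cu, cut, cux, cuxx, -, -, pde, int, mpos, mcons⟩ := hu
  obtain ⟨hb0, hb3⟩ := hb
  have d1 : ∀ s x, HasDerivAt (u s) (deriv (u s) x) x := fun s x =>
    (((ux3 s).differentiable (by norm_num)) x).hasDerivAt
  have d2 : ∀ s x, HasDerivAt (deriv (u s)) (deriv (deriv (u s)) x) x := fun s x => by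
    have : ContDiff ℝ 2 (deriv (u s)) := (contDiff_succ_iff_deriv (n := 2).1 (ux3 s)).2.2
    exact ((this.differentiable (by norm_num)) x).hasDerivAt
  set M : ℝ := ∫ x, mom u 0 x with hM
  have M0 : 0 ≤ M := integral_nonneg fun x => mpos 0 x le_rfl
  have sb : ∀ s, 0 ≤ s → (∀ x, |deriv (u s) x| ≤ u s x) ∧ (∀ x, u s x ≤ M) ∧
      (∫ x, u s x = M) ∧ Tendsto (u s) atTop (nhds 0) ∧ Tendsto (u s) atBot (nhds 0) := by
    intro s hs
    obtain ⟨i0, -, i1, -, i2, -⟩ := int s hs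
    have := static_bounds (u s) _ _ (d1 s) (d2 s) i0 i1 i2 (fun x => mpos s x hs)
    rw [show (∫ x, (u s x - deriv (deriv (u s)) x)) = M from mcons s hs] at this
    exact this
  have u0 : ∀ s x, 0 ≤ s → 0 ≤ u s x := fun s x hs => (abs_nonneg _).trans ((sb s hs).1 x)
  have ux2 : ∀ s x, 0 ≤ s → (deriv (u s) x) ^ 2 ≤ (u s x) ^ 2 := fun s x hs =>
    sq_le_sq.2 (by rw [abs_of_nonneg (u0 s x hs)]; exact (sb s hs).1 x)
  have uM : ∀ s x, 0 ≤ s → (u s x) ^ 2 ≤ M * u s x := fun s x hs => by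
    nlinarith [u0 s x hs, (sb s hs).2.1 x]
  set f : ℝ → ℝ → ℝ := fun s z => (b / 2) * (u s z) ^ 2 + ((3 - b) / 2) * (deriv (u s) z) ^ 2 with hf
  have f0 : ∀ s x, 0 ≤ f s x := fun s x => by
    have : 0 < 3 - b := by linarith
    simp only [hf]; positivity
  have fle : ∀ s x, 0 ≤ s → f s x ≤ 3 / 2 * (u s x) ^ 2 := fun s x hs => by
    simp only [hf]
    nlinarith [ux2 s x hs, sq_nonneg (u s x)]
  have cf : Continuous (fun p : ℝ × ℝ => f p.1 p.2) := by
    simp only [hf]; fun_prop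
  have cfs : ∀ s, Continuous (f s) := fun s =>
    cf.comp (by fun_prop : Continuous fun x : ℝ => (s, x))
  have cus : ∀ s, Continuous (u s) := fun s =>
    cu.comp (by fun_prop : Continuous fun x : ℝ => (s, x))
  have cuxs : ∀ s, Continuous (deriv (u s)) := fun s =>
    cux.comp (by fun_prop : Continuous fun x : ℝ => (s, x))
  have fi : ∀ s, 0 ≤ s → Integrable (f s) := fun s hs =>
    ((int s hs).2.1.const_mul _).add ((int s hs).2.2.2.1.const_mul _)
  have fint : ∀ s, 0 ≤ s → ∫ x, f s x ≤ 3 / 2 * M * M := by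
    intro s hs
    calc ∫ x, f s x ≤ ∫ x, 3 / 2 * M * u s x := by
          refine integral_mono (fi s hs) ((int s hs).1.const_mul _) fun x => ?_
          have := fle s x hs
          have := uM s x hs
          simp only
          linarith
      _ = 3 / 2 * M * M := by rw [integral_const_mul, (sb s hs).2.2.1]
  have gs := fun (s : ℝ) (hs : 0 ≤ s) => G_static (f s) (cfs s) (fi s hs) (f0 s)
  have hflux : ∀ s x, flux b u s x = 1 / 2 * (u s x) ^ 2 + G (f s) x := fun s x => rfl
  have hut : ∀ s x, HasDerivAt (fun s => u s x) (deriv (fun s => u s x) s) s := fun s x =>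
    (((ut1 x).differentiable (by norm_num)) s).hasDerivAt
  have hdf : ∀ s x, 0 < s → HasDerivAt (flux b u s) (-deriv (fun s => u s x) s) x := by
    intro s x hs
    obtain ⟨K1, hK, -⟩ := gs s hs.le
    have h := (((d1 s x).pow 2).const_mul (1 / 2)).add (hK x)
    have h' : DifferentiableAt ℝ (flux b u s) x := h.differentiableAt
    refine h'.hasDerivAt.congr_deriv ?_
    linarith [pde s x hs]
  have fabs : ∀ s, 0 ≤ s → ∀ x, |f s x| ≤ 3 / 2 * (M * M) := by
    intro s hs x
    rw [abs_of_nonneg (f0 s x)]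
    have := fle s x hs
    have := uM s x hs
    have := mul_le_mul_of_nonneg_left ((sb s hs).2.1 x) M0
    linarith
  have cJ : ∀ s x, 0 < s → ContinuousAt (fun p : ℝ × ℝ => flux b u p.1 p.2) (s, x) := by
    intro s x hs
    have h1 := G_cont f cf _ fabs s hs x
    have h2 : ContinuousAt (fun p : ℝ × ℝ => 1 / 2 * (u p.1 p.2) ^ 2) (s, x) := by fun_prop
    exact h2.add h1
  have K0 : ∀ s x, 0 ≤ s → 0 ≤ G (f s) x := fun s x hs => by
    obtain ⟨K1, -, -, -, h, -⟩ := gs s hs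
    exact h x
  have KM : ∀ s x, 0 ≤ s → G (f s) x ≤ M * M := fun s x hs => by
    obtain ⟨K1, -, -, -, -, h, -⟩ := gs s hs
    have := h x
    have := fint s hs
    nlinarith
  set σ : ℝ := 8 * (M + 1) with hσ
  have iψ : Integrable (fun y => W1 y - W3 y) := by
    refine W1_integrable.sub (W1_integrable.mono' W3_cont.aestronglyMeasurable
      (ae_of_all _ fun y => (W3_abs y).trans ?_))
    linarith [W1_pos y]
  have main := dyn u (fun s x => deriv (fun s => u s x) s) (flux b u)
    (fun y => W0 y - W2 y) (fun y => W1 y - W3 y) (2 * (M * M) + M) 2 σ cu cut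
    (fun s x _ => hut s x) hdf cJ
    (fun s x hs => by
      rw [hflux, abs_of_nonneg (by have := K0 s x hs.le; positivity)]
      have := KM s x hs.le
      have := uM s x hs.le
      have := mul_le_mul_of_nonneg_left ((sb s hs.le).2.1 x) M0
      have := mul_nonneg M0 M0
      linarith)
    (fun s x hs => by
      rw [abs_of_nonneg (u0 s x hs.le)]
      have := (sb s hs.le).2.1 x
      nlinarith)
    (fun s hs => by
      obtain ⟨K1, -, -, -, -, -, h, -⟩ := gs s hs.le
      have := (((sb s hs.le).2.2.2.1.pow 2).const_mul (1 / 2)).add h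
      rw [show (1 / 2 : ℝ) * 0 ^ 2 + 0 = 0 by norm_num] at this
      exact this)
    (fun s hs => by
      obtain ⟨K1, -, -, -, -, -, -, h⟩ := gs s hs.le
      have := (((sb s hs.le).2.2.2.2.pow 2).const_mul (1 / 2)).add h
      rw [show (1 / 2 : ℝ) * 0 ^ 2 + 0 = 0 by norm_num] at this
      exact this)
    (fun s hs => (int s hs.le).1) (fun x => (W0_hasDeriv x).sub (W2_hasDeriv x))
    (fun x => (abs_sub _ _).trans (by linarith [W0_abs x, W2_abs x, W1_le x]))
    (W1_cont.sub W3_cont) iψ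
  refine ⟨σ, by positivity, 4, by norm_num, 1 / (32 * (M + 1)), by positivity, fun t ht => ?_⟩
  have hFe : ∀ s, 0 < s → (∫ x : ℝ, phiW ((x - σ * s) / 4) * mom u s x) =
      ∫ x, (W0 (x - σ * s) - W2 (x - σ * s)) * u s x := by
    intro s hs
    obtain ⟨i0, -, i1, -, i2, -⟩ := int s hs.le
    have c0 := W0_cont
    have c1 := W1_cont
    have c2 := W2_cont
    have j0 : Integrable (fun x => W0 (x - σ * s) * u s x) :=
      i0.bdd_mul (c := 1) (by fun_prop) (ae_of_all _ fun x => W0_abs _)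
    have j1 : Integrable (fun x => W0 (x - σ * s) * deriv (u s) x) :=
      i1.bdd_mul (c := 1) (by fun_prop) (ae_of_all _ fun x => W0_abs _)
    have j2 : Integrable (fun x => W0 (x - σ * s) * deriv (deriv (u s)) x) :=
      i2.bdd_mul (c := 1) (by fun_prop) (ae_of_all _ fun x => W0_abs _)
    have k1 : Integrable (fun x => W1 (x - σ * s) * u s x) :=
      i0.bdd_mul (c := 1) (by fun_prop) (ae_of_all _ fun x => by
        rw [Real.norm_of_nonneg (W1_pos _).le]; exact W1_le _)
    have k2 : Integrable (fun x => W2 (x - σ * s) * u s x) :=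
      i0.bdd_mul (c := 1) (by fun_prop) (ae_of_all _ fun x => (W2_abs _).trans (W1_le _))
    have z : ∫ x, (W0 (x - σ * s) * deriv (deriv (u s)) x - W2 (x - σ * s) * u s x) = 0 := by
      refine integral_eq_zero_of_hasDerivAt_of_integrable
        (f := fun x => W0 (x - σ * s) * deriv (u s) x - W1 (x - σ * s) * u s x)
        (fun x => ?_) (j2.sub k2) (j1.sub k1)
      refine ((((W0_hasDeriv _).comp_sub_const x (σ * s)).mul (d2 s x)).sub
        (((W1_hasDeriv _).comp_sub_const x (σ * s)).mul (d1 s x))).congr_deriv ?_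
      ring
    have e : ∀ x, phiW ((x - σ * s) / 4) * mom u s x = (W0 (x - σ * s) - W2 (x - σ * s)) * u s x
        - (W0 (x - σ * s) * deriv (deriv (u s)) x - W2 (x - σ * s) * u s x) := by
      intro x
      have : phiW ((x - σ * s) / 4) = W0 (x - σ * s) := rfl
      rw [this]; unfold mom; ring
    simp only [e]
    have jk : Integrable (fun x => W0 (x - σ * s) * deriv (deriv (u s)) x
        - W2 (x - σ * s) * u s x) := j2.sub k2
    rw [integral_sub _ jk, z, sub_zero]
    refine (j0.sub k2).congr (ae_of_all _ fun x => ?_)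
    simp only [Pi.sub_apply]; ring
  have hder := (main t ht).congr_of_eventuallyEq
    (f₁ := fun s : ℝ => ∫ x : ℝ, phiW ((x - σ * s) / 4) * mom u s x) (by
      filter_upwards [lt_mem_nhds ht] with s hs
      exact hFe s hs)
  rw [hder.deriv]
  have tt := ht.le
  obtain ⟨K1, dK, dK1, bK1, -⟩ := gs t tt
  have c1 := W1_cont
  have c2 := W2_cont
  have c3 := W3_cont
  have cK : Continuous (G (f t)) := continuous_iff_continuousAt.2 fun y => (dK y).continuousAt
  have cK1 : Continuous K1 := continuous_iff_continuousAt.2 fun y => (dK1 y).continuousAt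
  have iW : ∀ (w g : ℝ → ℝ) (B : ℝ), Continuous w → Continuous g → (∀ y, |w y| ≤ W1 y) →
      (∀ y, |g y| ≤ B) → Integrable (fun x => w (x - σ * t) * g x) := by
    intro w g B cw cg hw hg
    refine (Integrable.comp_sub_right (f := w) (W1_integrable.mono' cw.aestronglyMeasurable
      (ae_of_all _ hw)) (σ * t)).mul_bdd (c := B) cg.aestronglyMeasurable (ae_of_all _ hg)
  have w1 : ∀ y, |W1 y| ≤ W1 y := fun y => (abs_of_pos (W1_pos y)).le
  have w3 : ∀ y, |W3 y| ≤ W1 y := fun y => (W3_abs y).trans (by linarith [W1_pos y])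
  have bK : ∀ y, |G (f t) y| ≤ M * M := fun y => by
    rw [abs_of_nonneg (K0 t y tt)]; exact KM t y tt
  have bK1' : ∀ y, |K1 y| ≤ M * M := fun y => (bK1 y).trans (KM t y tt)
  have bu : ∀ y, |u t y| ≤ M := fun y => by
    rw [abs_of_nonneg (u0 t y tt)]; exact (sb t tt).2.1 y
  have bu2 : ∀ y, |u t y ^ 2| ≤ M * M := fun y => by
    rw [abs_of_nonneg (sq_nonneg _)]
    have := uM t y tt
    have := mul_le_mul_of_nonneg_left ((sb t tt).2.1 y) M0
    linarith
  have cuxt := cuxs t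
  have cut' := cus t
  have cft := cfs t
  have n1K := iW W1 (G (f t)) _ c1 cK w1 bK
  have n3K := iW W3 (G (f t)) _ c3 cK w3 bK
  have n2K := iW W2 (G (f t)) _ c2 cK W2_abs bK
  have n1K1 := iW W1 K1 _ c1 cK1 w1 bK1'
  have n1f := iW W1 (f t) _ c1 cft w1 (fabs t tt)
  have n1u := iW W1 (u t) _ c1 cut' w1 bu
  have n3u := iW W3 (u t) _ c3 cut' w3 bu
  have n1u2 := iW W1 (fun x => u t x ^ 2) _ c1 (by fun_prop) w1 bu2
  have n3u2 := iW W3 (fun x => u t x ^ 2) _ c3 (by fun_prop) w3 bu2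
  have n1ux2 := iW W1 (fun x => deriv (u t) x ^ 2) (M * M) c1 (by fun_prop) w1 (fun y => by
    rw [abs_of_nonneg (sq_nonneg _)]
    exact (ux2 t y tt).trans ((le_abs_self _).trans (bu2 y)))
  have nz : Integrable (fun x => (W1 (x - σ * t) * G (f t) x - W1 (x - σ * t) * f t x)
      - W3 (x - σ * t) * G (f t) x) := (n1K.sub n1f).sub n3K
  have z : ∫ x, ((W1 (x - σ * t) * G (f t) x - W1 (x - σ * t) * f t x)
      - W3 (x - σ * t) * G (f t) x) = 0 := by
    refine integral_eq_zero_of_hasDerivAt_of_integrable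
      (f := fun x => W1 (x - σ * t) * K1 x - W2 (x - σ * t) * G (f t) x)
      (fun x => ?_) nz (n1K1.sub n2K)
    refine ((((W1_hasDeriv _).comp_sub_const x (σ * t)).mul (dK1 x)).sub
      (((W2_hasDeriv _).comp_sub_const x (σ * t)).mul (dK x))).congr_deriv ?_
    ring
  have nA : Integrable (fun x => (1 / 2) * (W1 (x - σ * t) * u t x ^ 2 - W3 (x - σ * t) * u t x ^ 2)
      - σ * (W1 (x - σ * t) * u t x - W3 (x - σ * t) * u t x) + W1 (x - σ * t) * f t x) :=
    (((n1u2.sub n3u2).const_mul (1 / 2)).sub ((n1u.sub n3u).const_mul σ)).add n1f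
  have e : ∀ x, (W1 (x - σ * t) - W3 (x - σ * t)) * (flux b u t x - σ * u t x) =
      ((1 / 2) * (W1 (x - σ * t) * u t x ^ 2 - W3 (x - σ * t) * u t x ^ 2)
      - σ * (W1 (x - σ * t) * u t x - W3 (x - σ * t) * u t x) + W1 (x - σ * t) * f t x) +
      ((W1 (x - σ * t) * G (f t) x - W1 (x - σ * t) * f t x) - W3 (x - σ * t) * G (f t) x) := by
    intro x
    rw [hflux]; ring
  simp only [e]
  rw [integral_add nA nz, z, add_zero, ← integral_const_mul]
  have cc : 1 / (32 * (M + 1)) * σ / 4 = 1 / 16 := by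
    rw [hσ]; field_simp; norm_num
  rw [cc]
  have es : ∀ x, sech2 ((x - σ * t) / 4) = 8 * W1 (x - σ * t) := fun x => by
    unfold W1; ring
  simp only [es]
  refine integral_mono nA (((n1u2.add n1ux2).const_mul (-(1 / 2))).congr
    (ae_of_all _ fun x => ?_)) fun x => ?_
  · simp only [Pi.add_apply]; ring
  · simp only
    have hw := W1_pos (x - σ * t)
    have h3 := abs_le.1 (W3_abs (x - σ * t))
    have hu0 := u0 t x tt
    have huM := uM t x tt
    have hf := fle t x tt
    have hx := ux2 t x tt
    set w := W1 (x - σ * t)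
    set v := W3 (x - σ * t)
    have a1 : (w - v) * u t x ^ 2 ≤ 5 / 4 * w * u t x ^ 2 :=
      mul_le_mul_of_nonneg_right (by linarith) (sq_nonneg _)
    have a2 : 3 / 4 * w * u t x ≤ (w - v) * u t x :=
      mul_le_mul_of_nonneg_right (by linarith) hu0
    have a3 : σ * (3 / 4 * w * u t x) ≤ σ * ((w - v) * u t x) :=
      mul_le_mul_of_nonneg_left a2 (by positivity)
    have a4 : w * f t x ≤ w * (3 / 2 * u t x ^ 2) := mul_le_mul_of_nonneg_left hf hw.le
    have a5 : w * deriv (u t) x ^ 2 ≤ w * u t x ^ 2 := mul_le_mul_of_nonneg_left hx hw.le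
    have a6 : w * u t x ^ 2 ≤ w * (M * u t x) := mul_le_mul_of_nonneg_left huM hw.le
    have a7 : 0 ≤ w * (M * u t x) := by positivity
    have a8 : σ * (3 / 4 * w * u t x) = 6 * (w * (M * u t x)) + 6 * (w * u t x) := by
      rw [hσ]; ring
    have a9 : 0 ≤ w * u t x := by positivity
    linarith
end
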